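/- arXiv:1707.08483 — 3 statements merged into one kernel-verified Lean document; each statement's English description precedes it below -/
import Mathlib

section
/- Let n ≥ 2 be an integer, α > 0, p ∈ {1,…,n−1} coprime to n, and let g be a type (i) coupling. Then for every r ∈ {1,…,n−1} and every ν ∈ S_n(ω_r), the function V_ν(g;·) is nonvanishing on the interior Σ_{g,p} of the simplex Σ̄_{g,p}, its sign is the same at every point of Σ_{g,p}, and moreover V_ν(g;x) and V_ν(g;−x) have the same sign for every x ∈ Σ_{g,p}. -/
noncomputable section
open Real Finset
open scoped Classical

/-- The standard basis vector `e_j` of `ℝⁿ` (1-based index), extended `n`-periodically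
(`e_{n+j} = e_j`). -/
def ee (n j : ℕ) : Fin n → ℝ := fun i => if ((i : ℕ) + 1) % n = j % n then 1 else 0

/-- The standard inner product on `ℝⁿ`. -/
def inn {n : ℕ} (x y : Fin n → ℝ) : ℝ := ∑ i, x i * y i

/-- The coordinate `x_j` (1-based index) with the convention `x_{n+k} = x_k - 2π/α`. -/
def coord {n : ℕ} (α : ℝ) (x : Fin n → ℝ) (j : ℕ) : ℝ :=
  if h : 0 < n then x ⟨(j - 1) % n, Nat.mod_lt _ h⟩ - 2 * π / α * (((j - 1) / n : ℕ) : ℝ)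
  else 0

/-- The simple roots `a_{j,p} = e_j - e_{j+p}`. -/
def aa (n p j : ℕ) : Fin n → ℝ := ee n j - ee n (j + p)

/-- The closed simplex `Σ̄_{g,p} = {x ∈ E_n : sgn(M)(x_j - x_{j+p} - g) ≥ 0, j = 1,…,n}`,
where `M = 2πp/α - ng`. -/
def SigmaBar (n p : ℕ) (α g : ℝ) : Set (Fin n → ℝ) :=
  {x | (∑ i, x i) = 0 ∧ ∀ j ∈ Icc 1 n,
    0 ≤ Real.sign (2 * π * p / α - n * g) * (coord α x j - coord α x (j + p) - g)}

/-- The interior `Σ_{g,p}` of the simplex, cut out by the strict inequalities. -/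
def SigmaInt (n p : ℕ) (α g : ℝ) : Set (Fin n → ℝ) :=
  {x | (∑ i, x i) = 0 ∧ ∀ j ∈ Icc 1 n,
    0 < Real.sign (2 * π * p / α - n * g) * (coord α x j - coord α x (j + p) - g)}

/-- `g` is a type (i) coupling, with `q ∈ {1,…,n-1}` the multiplicative inverse of `p` mod `n`. -/
def TypeI (n p q : ℕ) (α g : ℝ) : Prop :=
  1 ≤ q ∧ q ≤ n - 1 ∧ (p * q) % n = 1 % n ∧
  ((2 * π / α * ((p : ℝ) / n - 1 / ((n : ℝ) * q)) < g ∧ g < 2 * π / α * ((p : ℝ) / n)) ∨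
   (2 * π / α * ((p : ℝ) / n) < g ∧
      g < 2 * π / α * ((p : ℝ) / n + 1 / ((n : ℝ) * ((n : ℝ) - q)))))

/-- `ρ_p = g(ω_{1,p}+…+ω_{n-p,p}) + (g - 2π/α)(ω_{n-p+1,p}+…+ω_{n-1,p})`. -/
def rhoP (n p : ℕ) (α g : ℝ) (ω : ℕ → Fin n → ℝ) : Fin n → ℝ :=
  g • (∑ j ∈ Icc 1 (n - p), ω j) + (g - 2 * π / α) • (∑ j ∈ Icc (n - p + 1) (n - 1), ω j)

/-- `Λ⁺_{p,|M|}`: nonnegative integral combinations of the `ω_{j,p}` with coefficient sum `≤ |M|`. -/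
def Lam (n : ℕ) (Mabs : ℝ) (ω : ℕ → Fin n → ℝ) : Set (Fin n → ℝ) :=
  {μ | ∃ m : ℕ → ℕ, (∑ j ∈ Icc 1 (n - 1), (m j : ℝ)) ≤ Mabs ∧
    μ = ∑ j ∈ Icc 1 (n - 1), (m j : ℝ) • ω j}

/-- The fundamental weight `ω_r = e_1+…+e_r - (r/n)(e_1+…+e_n)`. -/
def omegaStd (n r : ℕ) : Fin n → ℝ :=
  fun i => (if (i : ℕ) + 1 ≤ r then 1 else 0) - (r : ℝ) / n

/-- Membership in the orbit `S_n(ω_r)` of `ω_r` under coordinate permutations. -/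
def inOrbit (n r : ℕ) (ν : Fin n → ℝ) : Prop :=
  ∃ σ : Equiv.Perm (Fin n), ν = fun i => omegaStd n r (σ i)

/-- The orbit `S_n(ω_r)` as a finite set. -/
def orbitF (n r : ℕ) : Finset (Fin n → ℝ) :=
  Finset.image (fun σ : Equiv.Perm (Fin n) => fun i => omegaStd n r (σ i)) Finset.univ

/-- `V_ν(g;x) = ∏_{a ∈ A_{n-1}, ⟨a,ν⟩=1} sin(α(⟨a,x⟩+g)/2)/sin(α⟨a,x⟩/2)`. -/
def Vnu (n : ℕ) (α g : ℝ) (ν x : Fin n → ℝ) : ℝ :=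
  ∏ j ∈ Icc 1 n, ∏ k ∈ Icc 1 n,
    if j ≠ k ∧ inn (ee n j - ee n k) ν = 1 then
      Real.sin (α * (inn (ee n j - ee n k) x + g) / 2) /
        Real.sin (α * inn (ee n j - ee n k) x / 2)
    else 1

/-- `V_J(g;x) = ∏_{j∈J, k∉J} sin(α(x_j-x_k+g)/2)/sin(α(x_j-x_k)/2)`. -/
def VJ (n : ℕ) (α g : ℝ) (J : Finset ℕ) (x : Fin n → ℝ) : ℝ :=
  ∏ j ∈ J, ∏ k ∈ Icc 1 n \ J,
    Real.sin (α * (coord α x j - coord α x k + g) / 2) /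
      Real.sin (α * (coord α x j - coord α x k) / 2)

/-- `F_J(g;x) = ∏_{j,k∈J, j≠k} sin(α(x_j-x_k)/2)/sin(α(x_j-x_k+g)/2)`. -/
def FJ (n : ℕ) (α g : ℝ) (J : Finset ℕ) (x : Fin n → ℝ) : ℝ :=
  ∏ j ∈ J, ∏ k ∈ J,
    if j ≠ k then
      Real.sin (α * (coord α x j - coord α x k) / 2) /
        Real.sin (α * (coord α x j - coord α x k + g) / 2)
    else 1

/-- The trigonometric Pochhammer symbol `(z : sin_α)_m`. -/
def poch (α z : ℝ) (m : ℤ) : ℝ :=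
  if 0 ≤ m then ∏ l ∈ Finset.range m.toNat, Real.sin (α * (z + l) / 2)
  else 1 / ∏ l ∈ Finset.Icc 1 (-m).toNat, Real.sin (α * (z - l) / 2)

/-- Membership in the set of positive roots `A⁺_{n-1,p}`. -/
def inPosRoots (n p : ℕ) (v : Fin n → ℝ) : Prop :=
  (∃ j ∈ Icc 1 n, ∃ k ∈ Icc 1 n, j ≠ k ∧ v = ee n j - ee n k) ∧
  ∃ c : ℕ → ℕ, v = ∑ j ∈ Icc 1 (n - 1), (c j : ℝ) • aa n p j

/-- The lattice function `Δ_p(μ)`. -/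
def Delta (n p : ℕ) (α g : ℝ) (ω : ℕ → Fin n → ℝ) (μ : Fin n → ℝ) : ℝ :=
  ∏ j ∈ Icc 1 n, ∏ k ∈ Icc 1 n,
    if inPosRoots n p (ee n j - ee n k) then
      Real.sin (α * inn (ee n j - ee n k)
          (rhoP n p α g ω + Real.sign (2 * π * p / α - n * g) • μ) / 2) /
        Real.sin (α * inn (ee n j - ee n k) (rhoP n p α g ω) / 2) *
      (poch α (inn (ee n j - ee n k) (rhoP n p α g ω) +
            Real.sign (2 * π * p / α - n * g) * g)
          ⌊Real.sign (2 * π * p / α - n * g) * inn (ee n j - ee n k) μ⌋ /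
        poch α (inn (ee n j - ee n k) (rhoP n p α g ω) + 1 -
            Real.sign (2 * π * p / α - n * g) * g)
          ⌊Real.sign (2 * π * p / α - n * g) * inn (ee n j - ee n k) μ⌋)
    else 1

/-- The coefficient `W_ν(ρ_p + sgn(M)μ)` (equal to `0` when `μ + ν ∉ Λ⁺_{p,|M|}`). -/
def Wmu (n p : ℕ) (α g : ℝ) (ω : ℕ → Fin n → ℝ) (s : (Fin n → ℝ) → ℝ)
    (μ ν : Fin n → ℝ) : ℝ :=
  if μ + ν ∈ Lam n |2 * π * p / α - n * g| ω then
    s ν * Real.sqrt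
      (Vnu n α g ν (rhoP n p α g ω + Real.sign (2 * π * p / α - n * g) • μ) *
       Vnu n α g ν (-(rhoP n p α g ω) - Real.sign (2 * π * p / α - n * g) • (μ + ν)))
  else 0

/-- The discrete difference operator `Ŝ_{r,M}` acting on lattice functions. -/
def SOp (n p r : ℕ) (α g : ℝ) (ω : ℕ → Fin n → ℝ) (s : (Fin n → ℝ) → ℝ)
    (φ : (Fin n → ℝ) → ℂ) : (Fin n → ℝ) → ℂ :=
  fun x => ∑ ν ∈ orbitF n r,
    (Wmu n p α g ω s (Real.sign (2 * π * p / α - n * g) • (x - rhoP n p α g ω)) ν : ℂ) *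
      φ (x + Real.sign (2 * π * p / α - n * g) • ν)

/-- The inner product `(φ, ψ)_{p,M}` on lattice functions. -/
def ip (n p : ℕ) (α g : ℝ) (ω : ℕ → Fin n → ℝ) (φ ψ : (Fin n → ℝ) → ℂ) : ℂ :=
  ∑ᶠ μ ∈ Lam n |2 * π * p / α - n * g| ω,
    φ (rhoP n p α g ω + Real.sign (2 * π * p / α - n * g) • μ) *
      starRingEnd ℂ (ψ (rhoP n p α g ω + Real.sign (2 * π * p / α - n * g) • μ))

/-- The elementary symmetric function `ℰ_r(u) = Σ_{ν ∈ S_n(ω_r)} exp(iα⟨ν,u⟩)`. -/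
def calE (n r : ℕ) (α : ℝ) (u : Fin n → ℝ) : ℂ :=
  ∑ ν ∈ orbitF n r, Complex.exp (Complex.I * (α : ℂ) * (inn ν u : ℂ))

/-- Two points in the same interval `(π c / q, π (c + 1) / q)` have sines of the same sign. -/
theorem sin_mul_sin_pos_of_same_interval {q c : ℤ} (hq : 0 < q) {u v : ℝ}
    (hu₁ : π * c < q * u) (hu₂ : q * u < π * (c + 1))
    (hv₁ : π * c < q * v) (hv₂ : q * v < π * (c + 1)) : 0 < sin u * sin v := by
  have hq' : (0 : ℝ) < q := by exact_mod_cast hq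
  have hlo : ((q * (c / q) : ℤ) : ℝ) ≤ c := by
    exact_mod_cast Int.mul_ediv_self_le hq.ne'
  have hhi : ((c + 1 : ℤ) : ℝ) ≤ ((q * (c / q) + q : ℤ) : ℝ) := by
    exact_mod_cast Int.lt_mul_ediv_self_add hq
  push_cast at hlo hhi
  have key : ∀ w : ℝ, π * c < q * w → q * w < π * (c + 1) →
      0 < sin (w - (c / q : ℤ) * π) := by
    intro w h₁ h₂
    apply sin_pos_of_pos_of_lt_pi
    · have : 0 < q * (w - (c / q : ℤ) * π) := by nlinarith [pi_pos]
      exact pos_of_mul_pos_right this hq'.le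
    · have : q * (w - (c / q : ℤ) * π) < q * π := by nlinarith [pi_pos]
      exact lt_of_mul_lt_mul_left this hq'.le
  have hprod := mul_pos (key u hu₁ hu₂) (key v hv₁ hv₂)
  rw [sin_sub_int_mul_pi, sin_sub_int_mul_pi] at hprod
  have hsq : ((-1 : ℝ) ^ (c / q)) * (-1) ^ (c / q) = 1 := by
    rw [← mul_zpow]; simp
  calc 0 < _ := hprod
    _ = ((-1 : ℝ) ^ (c / q) * (-1) ^ (c / q)) * (sin u * sin v) := by ring
    _ = sin u * sin v := by rw [hsq, one_mul]

/-- The arithmetic content of a type (i) coupling, for `γ = αg/2`: the coupling lies between `πp/n`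
and a neighbouring Farey fraction times `π`. -/
theorem TypeI.farey {n p q : ℕ} {α g : ℝ} (hn : 2 ≤ n) (hα : 0 < α) (h : TypeI n p q α g) :
    (∃ t q' : ℤ, 0 < q' ∧ (p : ℝ) * q' = 1 + n * t ∧ π * t < q' * (α * g / 2) ∧
      n * (α * g / 2) < π * p) ∨
    (∃ t q' : ℤ, 0 < q' ∧ (p : ℝ) * q' = n * t - 1 ∧ q' * (α * g / 2) < π * t ∧
      π * p < n * (α * g / 2)) := by
  obtain ⟨hq₁, hqn, hpq, hg⟩ := h
  have hn0 : (0 : ℝ) < n := by positivity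
  have hq0 : (0 : ℝ) < q := by positivity
  have hdiv : (p : ℝ) * q = 1 + n * ((p * q / n : ℕ) : ℝ) := by
    have := Nat.mod_add_div (p * q) n
    rw [hpq, Nat.mod_eq_of_lt (by omega : 1 < n)] at this
    exact_mod_cast this.symm
  set t : ℕ := p * q / n
  rcases hg with ⟨h₁, h₂⟩ | ⟨h₁, h₂⟩
  · refine Or.inl ⟨t, q, by exact_mod_cast hq₁, by exact_mod_cast hdiv, ?_, ?_⟩
    · have e : 2 * π / α * ((p : ℝ) / n - 1 / ((n : ℝ) * q)) = 2 * π * t / (α * q) := by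
        field_simp
        linear_combination hdiv
      rw [e, div_lt_iff₀ (by positivity)] at h₁
      push_cast
      linarith
    · have e : 2 * π / α * ((p : ℝ) / n) = 2 * π * p / (α * n) := by field_simp
      rw [e, lt_div_iff₀ (by positivity)] at h₂
      linarith
  · have hnq : (0 : ℝ) < n - q := by
      have : (q : ℝ) < n := by exact_mod_cast (by omega : q < n)
      linarith
    refine Or.inr ⟨p - t, n - q, by omega, ?_, ?_, ?_⟩
    · push_cast
      linear_combination -hdiv
    · have e : 2 * π / α * ((p : ℝ) / n + 1 / ((n : ℝ) * (n - q))) =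
          2 * π * (p - t) / (α * (n - q)) := by
        field_simp
        linear_combination -hdiv
      rw [e, lt_div_iff₀ (by positivity)] at h₂
      push_cast
      linarith
    · have e : 2 * π / α * ((p : ℝ) / n) = 2 * π * p / (α * n) := by field_simp
      rw [e, div_lt_iff₀ (by positivity)] at h₁
      linarith

theorem coord_add_card {n : ℕ} (hn : 0 < n) (α : ℝ) (x : Fin n → ℝ) (j k : ℕ) (hj : 1 ≤ j) :
    coord α x (j + n * k) = coord α x j - 2 * π / α * k := by
  obtain ⟨i, rfl⟩ : ∃ i, j = i + 1 := ⟨j - 1, by omega⟩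
  have e : i + 1 + n * k - 1 = i + n * k := by omega
  simp only [coord, hn, dite_true, e, Nat.add_sub_cancel, Nat.add_mul_mod_self_left,
    Nat.add_mul_div_left _ _ hn]
  push_cast
  ring

theorem coord_fin {n : ℕ} (α : ℝ) (x : Fin n → ℝ) (a : Fin n) : coord α x (a + 1) = x a := by
  have hn : 0 < n := a.pos
  simp [coord, hn, Nat.mod_eq_of_lt a.2, Nat.div_eq_of_lt a.2]

/-- The defining inequalities of the simplex, iterated along the cycle `j, j + p, j + 2p, …`. -/
theorem coord_chain_pos {n p : ℕ} {α g : ℝ} (hn : 0 < n) {x : Fin n → ℝ}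
    (hx : x ∈ SigmaInt n p α g) {j : ℕ} (hj : 1 ≤ j) (m : ℕ) :
    0 < Real.sign (2 * π * p / α - n * g) *
      (coord α x j - coord α x (j + (m + 1) * p) - (m + 1) * g) := by
  have step : ∀ j, 1 ≤ j → 0 < Real.sign (2 * π * p / α - n * g) *
      (coord α x j - coord α x (j + p) - g) := by
    intro j hj
    have hlt := Nat.mod_lt (j - 1) hn
    have hdecomp := Nat.mod_add_div (j - 1) n
    have h := hx.2 ((j - 1) % n + 1) (Finset.mem_Icc.2 ⟨by omega, by omega⟩)
    have e₁ : j = ((j - 1) % n + 1) + n * ((j - 1) / n) := by omega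
    have e₂ : j + p = ((j - 1) % n + 1 + p) + n * ((j - 1) / n) := by omega
    have f₁ := coord_add_card hn α x ((j - 1) % n + 1) ((j - 1) / n) (by omega)
    have f₂ := coord_add_card hn α x ((j - 1) % n + 1 + p) ((j - 1) / n) (by omega)
    rw [← e₁] at f₁
    rw [← e₂] at f₂
    rw [f₁, f₂]
    convert h using 2
    ring
  induction m with
  | zero => simpa using step j hj
  | succ m ih =>
    have h := step (j + (m + 1) * p) (by omega)
    have e : j + (m + 1) * p + p = j + (m + 1 + 1) * p := by ring
    rw [e] at h
    push_cast
    linarith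

/-- The sine factors of `V_ν` have constant sign on the simplex. -/
theorem sin_coord_sub_mul_pos {n p q : ℕ} {α g : ℝ} (hn : 2 ≤ n) (hα : 0 < α)
    (htype : TypeI n p q α g) {x y : Fin n → ℝ} (hx : x ∈ SigmaInt n p α g)
    (hy : y ∈ SigmaInt n p α g) {a b : Fin n} (hab : a ≠ b) {e : ℕ} (he : e ≤ 1) :
    0 < sin (α * (x a - x b + e * g) / 2) * sin (α * (y a - y b + e * g) / 2) := by
  have hn0 : 0 < n := by omega
  obtain ⟨m, ℓ, hm, hmn, hmb⟩ : ∃ m ℓ : ℕ, 0 < m ∧ m < n ∧ (a : ℕ) + m * p = b + n * ℓ := by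
    obtain ⟨-, -, hpq, -⟩ := htype
    have hmod : ((a : ℕ) + (((b : ℕ) + (n - a)) * q % n) * p) % n = b := by
      have hc : (a : ℕ) + (((b : ℕ) + (n - a)) * q % n) * p ≡ b [MOD n] := by
        calc (a : ℕ) + (((b : ℕ) + (n - a)) * q % n) * p
            ≡ a + (((b : ℕ) + (n - a)) * q) * p [MOD n] :=
              ((Nat.mod_modEq _ _).mul_right _).add_left _
          _ = a + ((b : ℕ) + (n - a)) * (p * q) := by ring
          _ ≡ a + ((b : ℕ) + (n - a)) * 1 [MOD n] :=
              (Nat.ModEq.mul_left _ hpq).add_left _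
          _ = b + n := by have := a.2; omega
          _ ≡ b [MOD n] := by simp [Nat.ModEq]
      rw [hc, Nat.mod_eq_of_lt b.2]
    have hdiv := Nat.mod_add_div ((a : ℕ) + (((b : ℕ) + (n - a)) * q % n) * p) n
    rw [hmod] at hdiv
    refine ⟨((b : ℕ) + (n - a)) * q % n, _, ?_, Nat.mod_lt _ hn0, hdiv.symm⟩
    rcases Nat.eq_zero_or_pos (((b : ℕ) + (n - a)) * q % n) with h0 | h0
    · rw [h0, zero_mul, add_zero, Nat.mod_eq_of_lt a.2] at hmod
      exact absurd (Fin.ext hmod) hab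
    · exact h0
  have bounds : ∀ z ∈ SigmaInt n p α g,
      0 < Real.sign (2 * π * p / α - n * g) *
        (α * (z a - z b + e * g) / 2 + ℓ * π - (m + e) * (α * g / 2)) ∧
      0 < Real.sign (2 * π * p / α - n * g) *
        (π * p - (n - (m + e)) * (α * g / 2) - (α * (z a - z b + e * g) / 2 + ℓ * π)) := by
    intro z hz
    have hb : coord α z (a + 1 + m * p) = z b - 2 * π / α * ℓ := by
      rw [show (a : ℕ) + 1 + m * p = b + 1 + n * ℓ by omega,
        coord_add_card hn0 α z _ _ (by omega), coord_fin]
    have h₁ := coord_chain_pos hn0 hz (j := a + 1) (by omega) (m - 1)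
    have h₂ := coord_chain_pos hn0 hz (j := a + 1 + m * p) (by omega) (n - m - 1)
    have c₁ : ((m - 1 : ℕ) : ℝ) + 1 = m := by
      exact_mod_cast (by omega : m - 1 + 1 = m)
    have c₂ : ((n - m - 1 : ℕ) : ℝ) + 1 = n - m := by
      rw [eq_sub_iff_add_eq]
      exact_mod_cast (by omega : n - m - 1 + 1 + m = n)
    have c₃ : (a : ℕ) + 1 + m * p + (n - m - 1 + 1) * p = a + 1 + n * p := by
      rw [add_assoc, ← add_mul]
      congr 2
      omega
    rw [c₁, show m - 1 + 1 = m by omega, hb, coord_fin] at h₁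
    rw [c₂, c₃, hb, coord_add_card hn0 α z _ _ (by omega), coord_fin] at h₂
    have hα2 : 0 < α / 2 := by positivity
    generalize Real.sign (2 * π * p / α - n * g) = s at h₁ h₂ ⊢
    constructor
    · refine (mul_pos hα2 h₁).trans_eq ?_
      field_simp
      ring
    · refine (mul_pos hα2 h₂).trans_eq ?_
      field_simp
      ring
  have reduce : ∀ w : ℝ, sin (w + ℓ * π) = (-1) ^ ℓ * sin w := fun w => sin_add_nat_mul_pi w ℓ
  have hsq : ((-1 : ℝ) ^ ℓ) * (-1) ^ ℓ = 1 := by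
    rw [← mul_pow]; simp
  suffices H : 0 < sin (α * (x a - x b + e * g) / 2 + ℓ * π) *
      sin (α * (y a - y b + e * g) / 2 + ℓ * π) by
    rw [reduce, reduce] at H
    calc 0 < _ := H
      _ = ((-1 : ℝ) ^ ℓ * (-1) ^ ℓ) *
          (sin (α * (x a - x b + e * g) / 2) * sin (α * (y a - y b + e * g) / 2)) := by ring
      _ = _ := by rw [hsq, one_mul]
  obtain ⟨hx₁, hx₂⟩ := bounds x hx
  obtain ⟨hy₁, hy₂⟩ := bounds y hy
  generalize α * (x a - x b + e * g) / 2 + ℓ * π = u at *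
  generalize α * (y a - y b + e * g) / 2 + ℓ * π = v at *
  have hk₀ : (0 : ℝ) ≤ (m + e : ℕ) := Nat.cast_nonneg _
  have hk : ((m + e : ℕ) : ℝ) ≤ n := by exact_mod_cast (by omega : m + e ≤ n)
  have hke : (m : ℝ) + e = (m + e : ℕ) := by push_cast; ring
  rw [hke] at hx₁ hx₂ hy₁ hy₂
  generalize m + e = k at hk₀ hk hx₁ hx₂ hy₁ hy₂
  have hM : 2 * π * p / α - n * g = 2 / α * (π * p - n * (α * g / 2)) := by
    field_simp
  rcases htype.farey hn hα with ⟨t, q', hq', hpq, hlo, hhi⟩ | ⟨t, q', hq', hpq, hlo, hhi⟩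
  · have hs : Real.sign (2 * π * p / α - n * g) = 1 := by
      apply Real.sign_of_pos
      rw [hM]
      exact mul_pos (by positivity) (by linarith)
    rw [hs, one_mul] at hx₁ hx₂ hy₁ hy₂
    have hq'' : (0 : ℝ) < q' := by exact_mod_cast hq'
    have l₁ := mul_le_mul_of_nonneg_left hlo.le hk₀
    have l₂ := mul_le_mul_of_nonneg_left hlo.le (sub_nonneg.2 hk)
    have hpq' : π * ((p : ℝ) * q') = π * (1 + n * t) := by rw [hpq]
    refine sin_mul_sin_pos_of_same_interval (c := k * t) hq' ?_ ?_ ?_ ?_ <;> push_cast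
    · linarith [mul_pos hq'' hx₁]
    · linarith [mul_pos hq'' hx₂]
    · linarith [mul_pos hq'' hy₁]
    · linarith [mul_pos hq'' hy₂]
  · have hs : Real.sign (2 * π * p / α - n * g) = -1 := by
      apply Real.sign_of_neg
      rw [hM]
      exact mul_neg_of_pos_of_neg (by positivity) (by linarith)
    rw [hs] at hx₁ hx₂ hy₁ hy₂
    have hq'' : (0 : ℝ) < q' := by exact_mod_cast hq'
    have l₁ := mul_le_mul_of_nonneg_left hlo.le hk₀
    have l₂ := mul_le_mul_of_nonneg_left hlo.le (sub_nonneg.2 hk)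
    have hpq' : π * ((p : ℝ) * q') = π * (n * t - 1) := by rw [hpq]
    refine sin_mul_sin_pos_of_same_interval (c := k * t - 1) hq' ?_ ?_ ?_ ?_ <;> push_cast
    · linarith [mul_pos hq'' hx₂]
    · linarith [mul_pos hq'' hx₁]
    · linarith [mul_pos hq'' hy₂]
    · linarith [mul_pos hq'' hy₁]

/-- The factor of `V_ν` attached to the ordered pair `(a, b)`, set to `1` on the diagonal. -/
def pairFactor {n : ℕ} (α g : ℝ) (x : Fin n → ℝ) (a b : Fin n) : ℝ :=
  if a = b then 1 else sin (α * (x a - x b + g) / 2) / sin (α * (x a - x b) / 2)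

theorem pairFactor_neg {n : ℕ} (α g : ℝ) (x : Fin n → ℝ) (a b : Fin n) :
    pairFactor α g (-x) a b = pairFactor α g x b a := by
  simp only [pairFactor, eq_comm (a := a), Pi.neg_apply]
  rw [show -x a - -x b = x b - x a by ring]

theorem pairFactor_mul_pos {n p q : ℕ} {α g : ℝ} (hn : 2 ≤ n) (hα : 0 < α)
    (htype : TypeI n p q α g) {x y : Fin n → ℝ} (hx : x ∈ SigmaInt n p α g)
    (hy : y ∈ SigmaInt n p α g) (a b : Fin n) :
    0 < pairFactor α g x a b * pairFactor α g y a b := by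
  unfold pairFactor
  split_ifs with hab
  · norm_num
  · have h₁ := sin_coord_sub_mul_pos hn hα htype hx hy hab (le_refl 1)
    have h₀ := sin_coord_sub_mul_pos hn hα htype hx hy hab zero_le_one
    simp only [Nat.cast_one, one_mul, Nat.cast_zero, zero_mul, add_zero] at h₁ h₀
    rw [div_mul_div_comm]
    exact div_pos h₁ h₀

theorem inn_ee_sub_ee {n : ℕ} (x : Fin n → ℝ) (a b : Fin n) :
    inn (ee n (a + 1) - ee n (b + 1)) x = x a - x b := by
  have hmod : ∀ i c : Fin n, ((i : ℕ) + 1) % n = ((c : ℕ) + 1) % n ↔ i = c := by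
    intro i c
    constructor
    · intro h
      have h' : (i : ℕ) ≡ c [MOD n] := Nat.ModEq.add_right_cancel' 1 h
      exact Fin.ext (Nat.ModEq.eq_of_lt_of_lt h' i.2 c.2)
    · rintro rfl
      rfl
  simp [inn, ee, hmod, sub_mul, Finset.sum_sub_distrib]

theorem prod_Icc_one_eq_prod_fin (n : ℕ) (f : ℕ → ℝ) :
    ∏ j ∈ Icc 1 n, f j = ∏ a : Fin n, f (a + 1) := by
  rw [← Finset.prod_range (fun i => f (i + 1)), Finset.range_eq_Ico,
    Finset.prod_Ico_add' f 0 n 1]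
  rfl

/-- For `ν` in the orbit of a fundamental weight, `V_ν` is a product over `J × Jᶜ`. -/
theorem Vnu_eq_prod_pairFactor {n r : ℕ} {ν : Fin n → ℝ} (hν : inOrbit n r ν) (α g : ℝ) :
    ∃ J : Finset (Fin n), ∀ x, Vnu n α g ν x = ∏ a ∈ J, ∏ b ∈ Jᶜ, pairFactor α g x a b := by
  obtain ⟨σ, rfl⟩ := hν
  refine ⟨Finset.univ.filter fun a => (σ a : ℕ) + 1 ≤ r, fun x => ?_⟩
  rw [Vnu, prod_Icc_one_eq_prod_fin, Finset.prod_filter]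
  refine Finset.prod_congr rfl fun a _ => ?_
  rw [prod_Icc_one_eq_prod_fin, Finset.compl_filter, Finset.prod_filter]
  simp only [inn_ee_sub_ee, omegaStd]
  by_cases ha : (σ a : ℕ) + 1 ≤ r
  · simp only [ha, if_true]
    refine Finset.prod_congr rfl fun b _ => ?_
    by_cases hb : (σ b : ℕ) + 1 ≤ r
    · simp [hb]
    · have hab : a ≠ b := by
        rintro rfl
        exact hb ha
      simp [hb, hab, pairFactor, Fin.val_inj]
  · simp only [ha, if_false]
    refine Finset.prod_eq_one fun b _ => if_neg fun h => ?_
    have := h.2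
    split_ifs at this <;> linarith

/-- A cut product of `K a b * K b a` is positive as soon as all its full row products are. -/
theorem prod_cut_pos {ι : Type*} [Fintype ι] [DecidableEq ι] (K : ι → ι → ℝ) (hK : ∀ a b, K a b ≠ 0)
    (hrow : ∀ a, 0 < ∏ b, K a b * K b a) (J : Finset ι) :
    0 < ∏ a ∈ J, ∏ b ∈ Jᶜ, K a b * K b a := by
  have hin : 0 < ∏ a ∈ J, ∏ b ∈ J, K a b * K b a := by
    have e : ∏ a ∈ J, ∏ b ∈ J, K a b * K b a = (∏ a ∈ J, ∏ b ∈ J, K a b) ^ 2 := by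
      simp only [Finset.prod_mul_distrib]
      rw [Finset.prod_comm (f := fun a b => K b a), sq]
    rw [e]
    exact sq_pos_of_ne_zero (Finset.prod_ne_zero_iff.2 fun a _ =>
      Finset.prod_ne_zero_iff.2 fun b _ => hK a b)
  have hall : 0 < ∏ a ∈ J, ∏ b, K a b * K b a := Finset.prod_pos fun a _ => hrow a
  simp only [← Finset.prod_mul_prod_compl J (fun b => K _ b * K b _),
    Finset.prod_mul_distrib (s := J)] at hall hin ⊢
  exact pos_of_mul_pos_right hall hin.le

/-- The barycenter of the simplex. -/
def sigmaCenter (n : ℕ) (α : ℝ) : Fin n → ℝ :=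
  fun i => 2 * π / (α * n) * ((n - 1) / 2 - (i : ℕ))

theorem sigmaCenter_mem {n p : ℕ} {α g : ℝ} (hn : 0 < n) (hα : 0 < α)
    (hM : 2 * π * p / α - n * g ≠ 0) : sigmaCenter n α ∈ SigmaInt n p α g := by
  have hn' : (0 : ℝ) < n := by exact_mod_cast hn
  constructor
  · have hsum : ∑ i : Fin n, ((i : ℕ) : ℝ) = n * (n - 1) / 2 := by
      rw [Fin.sum_univ_eq_sum_range (fun i => (i : ℝ)) n]
      have h := Finset.sum_range_id_mul_two n
      have h' : (∑ i ∈ Finset.range n, (i : ℝ)) * 2 = n * ((n - 1 : ℕ) : ℝ) := by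
        rw [← Nat.cast_mul, ← h]
        push_cast
        ring
      rw [Nat.cast_sub hn, Nat.cast_one] at h'
      linarith
    simp only [sigmaCenter, ← Finset.mul_sum, Finset.sum_sub_distrib, hsum]
    simp only [Finset.sum_const, Finset.card_univ, Fintype.card_fin, nsmul_eq_mul]
    ring
  · have hc : ∀ i : ℕ, coord α (sigmaCenter n α) (i + 1) =
        2 * π / (α * n) * ((n - 1) / 2 - i) := by
      intro i
      have h : ((i % n : ℕ) : ℝ) + n * ((i / n : ℕ) : ℝ) = i := by
        exact_mod_cast Nat.mod_add_div i n
      simp only [coord, hn, dite_true, sigmaCenter, Nat.add_sub_cancel]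
      rw [← h]
      field_simp
      ring
    intro j hj
    obtain ⟨i, rfl⟩ : ∃ i, j = i + 1 := ⟨j - 1, by have := (Finset.mem_Icc.1 hj).1; omega⟩
    rw [show i + 1 + p = i + p + 1 by ring, hc, hc]
    have e : 2 * π / (α * n) * (((n : ℝ) - 1) / 2 - i) -
        2 * π / (α * n) * (((n : ℝ) - 1) / 2 - ((i + p : ℕ) : ℝ)) - g =
        (2 * π * p / α - n * g) / n := by
      push_cast
      field_simp
      ring
    rw [e, mul_div_assoc']
    refine div_pos ?_ hn'
    rcases lt_or_gt_of_ne hM with h | h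
    · rw [Real.sign_of_neg h]
      linarith
    · rw [Real.sign_of_pos h]
      linarith

/-- At the barycenter the pair factors depend only on the cyclic difference of the indices. -/
theorem pairFactor_sigmaCenter {n : ℕ} [NeZero n] {α : ℝ} (hα : 0 < α) (g : ℝ) (a b : Fin n) :
    pairFactor α g (sigmaCenter n α) a b =
      if b - a = 0 then 1 else
        sin (π * ((b - a : Fin n) : ℕ) / n + α * g / 2) / sin (π * ((b - a : Fin n) : ℕ) / n) := by
  have hn' : (0 : ℝ) < n := by exact_mod_cast NeZero.pos n
  simp only [pairFactor, sub_eq_zero, eq_comm (a := b)]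
  split_ifs with hab
  · rfl
  obtain ⟨ℓ, hℓ⟩ : ∃ ℓ : ℤ, (((b - a : Fin n) : ℕ) : ℝ) = (b : ℕ) - (a : ℕ) + n * ℓ := by
    have h : (((n - a + b) % n : ℕ) : ℝ) + n * (((n - a + b) / n : ℕ) : ℝ) =
        ((n - a + b : ℕ) : ℝ) := by
      exact_mod_cast Nat.mod_add_div (n - a + b) n
    rw [Nat.cast_add, Nat.cast_sub a.2.le] at h
    rw [Fin.sub_def]
    generalize (n - (a : ℕ) + b) / n = d at h
    refine ⟨1 - d, ?_⟩
    push_cast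
    linarith
  have e₀ : π * (((b - a : Fin n) : ℕ) : ℝ) / n =
      α * (sigmaCenter n α a - sigmaCenter n α b) / 2 + ℓ * π := by
    rw [hℓ]
    simp only [sigmaCenter]
    field_simp
    ring
  have e₁ : π * (((b - a : Fin n) : ℕ) : ℝ) / n + α * g / 2 =
      α * (sigmaCenter n α a - sigmaCenter n α b + g) / 2 + ℓ * π := by
    rw [e₀]
    ring
  rw [e₁, e₀, sin_add_int_mul_pi, sin_add_int_mul_pi, mul_div_mul_left]
  exact zpow_ne_zero _ (by norm_num)

theorem sign_eq_sign_of_mul_pos {u v : ℝ} (h : 0 < u * v) : Real.sign u = Real.sign v := by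
  rcases mul_pos_iff.1 h with ⟨hu, hv⟩ | ⟨hu, hv⟩
  · rw [Real.sign_of_pos hu, Real.sign_of_pos hv]
  · rw [Real.sign_of_neg hu, Real.sign_of_neg hv]

/-- for a type (i) coupling, each `V_ν(g;·)` is nonvanishing and of constant
sign on the interior `Σ_{g,p}`, and `V_ν(g;x)`, `V_ν(g;-x)` have the same sign there. -/
theorem statement4 (n p q : ℕ) (α g : ℝ)
    (hn : 2 ≤ n) (hα : 0 < α) (hp1 : 1 ≤ p) (hpn : p ≤ n - 1) (hcop : Nat.Coprime p n)
    (htype : TypeI n p q α g)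
    (r : ℕ) (hr1 : 1 ≤ r) (hrn : r ≤ n - 1)
    (ν : Fin n → ℝ) (hν : inOrbit n r ν) :
    (∀ x ∈ SigmaInt n p α g, Vnu n α g ν x ≠ 0) ∧
    (∀ x ∈ SigmaInt n p α g, ∀ y ∈ SigmaInt n p α g,
      Real.sign (Vnu n α g ν x) = Real.sign (Vnu n α g ν y)) ∧
    (∀ x ∈ SigmaInt n p α g,
      Real.sign (Vnu n α g ν x) = Real.sign (Vnu n α g ν (-x))) := by
  have hn0 : 0 < n := by omega
  have : NeZero n := ⟨hn0.ne'⟩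
  obtain ⟨J, hJ⟩ := Vnu_eq_prod_pairFactor hν α g
  have hpos : ∀ x ∈ SigmaInt n p α g, ∀ y ∈ SigmaInt n p α g,
      0 < Vnu n α g ν x * Vnu n α g ν y := by
    intro x hx y hy
    simp only [hJ, ← Finset.prod_mul_distrib]
    exact Finset.prod_pos fun a _ => Finset.prod_pos fun b _ =>
      pairFactor_mul_pos hn hα htype hx hy a b
  have hneg : ∀ x ∈ SigmaInt n p α g, ∀ y ∈ SigmaInt n p α g,
      0 < Vnu n α g ν (-x) * Vnu n α g ν (-y) := by
    intro x hx y hy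
    simp only [hJ, pairFactor_neg, ← Finset.prod_mul_distrib]
    exact Finset.prod_pos fun a _ => Finset.prod_pos fun b _ =>
      pairFactor_mul_pos hn hα htype hx hy b a
  refine ⟨fun x hx h => by simpa [h] using hpos x hx x hx,
    fun x hx y hy => sign_eq_sign_of_mul_pos (hpos x hx y hy), fun x hx => ?_⟩
  have hM : 2 * π * p / α - n * g ≠ 0 := by
    intro h
    simpa [h] using hx.2 1 (Finset.mem_Icc.2 ⟨le_rfl, by omega⟩)
  have hc := sigmaCenter_mem hn0 hα hM
  rw [sign_eq_sign_of_mul_pos (hpos x hx _ hc), sign_eq_sign_of_mul_pos (hneg x hx _ hc)]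
  apply sign_eq_sign_of_mul_pos
  have hne : ∀ a b, pairFactor α g (sigmaCenter n α) a b ≠ 0 := fun a b h => by
    simpa [h] using pairFactor_mul_pos hn hα htype hc hc a b
  simp only [hJ, pairFactor_neg, ← Finset.prod_mul_distrib]
  refine prod_cut_pos _ hne (fun a => ?_) J
  set κ : Fin n → ℝ := fun c =>
    if c = 0 then 1 else sin (π * (c : ℕ) / n + α * g / 2) / sin (π * (c : ℕ) / n)
  have hκ : ∀ a b, pairFactor α g (sigmaCenter n α) a b = κ (b - a) :=
    pairFactor_sigmaCenter hα g
  have hsq : ∏ b, pairFactor α g (sigmaCenter n α) a b * pairFactor α g (sigmaCenter n α) b a =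
      (∏ c, κ c) ^ 2 := by
    simp only [hκ, Finset.prod_mul_distrib]
    exact (congrArg₂ (· * ·) (Equiv.prod_comp (Equiv.subRight a) κ)
      (Equiv.prod_comp (Equiv.subLeft a) κ)).trans (sq _).symm
  rw [hsq]
  refine sq_pos_of_ne_zero (Finset.prod_ne_zero_iff.2 fun c _ => ?_)
  simpa [hκ] using hne 0 c
end
end

section
/- Let n ≥ 2 be an integer, α > 0, p ∈ {1,…,n−1} coprime to n, and let g be a type (i) coupling. Then for every subset J ⊆ {1,…,n} and every x ∈ Σ̄_{g,p}, one has V_J(g;x)·V_J(g;−x) ≥ 0, and the inequality is strict whenever x lies in the interior Σ_{g,p}. -/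
noncomputable section
open Real Finset
open scoped Classical

lemma neg_one_pow_mul_sin_nonneg (N : ℕ) {θ : ℝ} (h0 : N * π ≤ θ) (h1 : θ ≤ (N + 1) * π) :
    0 ≤ (-1) ^ N * Real.sin θ := by
  rw [← Real.sin_sub_nat_mul_pi]
  exact Real.sin_nonneg_of_nonneg_of_le_pi (by linarith) (by linarith)

lemma neg_one_pow_mul_sin_pos (N : ℕ) {θ : ℝ} (h0 : N * π < θ) (h1 : θ < (N + 1) * π) :
    0 < (-1) ^ N * Real.sin θ := by
  rw [← Real.sin_sub_nat_mul_pi]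
  exact Real.sin_pos_of_pos_of_lt_pi (by linarith) (by linarith)

/-- If the rows and columns of a sign matrix `e` all have the same product, then the signs `e j k`
cancel out in a product over the pairs separated by `J`. -/
lemma prod_separated_signs {ι : Type*} [DecidableEq ι] (I J : Finset ι) (hJ : J ⊆ I) (e : ι → ι → ℝ) (C : ℝ)
    (he : ∀ j k, e j k * e j k = 1)
    (hrow : ∀ j ∈ I, ∏ k ∈ I, e j k = C) (hcol : ∀ j ∈ I, ∏ k ∈ I, e k j = C) :
    ∏ j ∈ J, ∏ k ∈ I \ J, e j k * e k j = 1 := by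
  have split : ∀ f : ι → ℝ, (∏ k ∈ I \ J, f k) * ∏ k ∈ J, f k = ∏ k ∈ I, f k :=
    fun f => Finset.prod_sdiff hJ
  have h1 : (∏ j ∈ J, ∏ k ∈ I \ J, e j k) * ∏ j ∈ J, ∏ k ∈ J, e j k = ∏ j ∈ J, C := by
    rw [← Finset.prod_mul_distrib]
    exact Finset.prod_congr rfl fun j hj => by rw [split, hrow j (hJ hj)]
  have h2 : (∏ j ∈ J, ∏ k ∈ I \ J, e k j) * ∏ j ∈ J, ∏ k ∈ J, e j k = ∏ j ∈ J, C := by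
    rw [Finset.prod_comm (s := J) (t := J), ← Finset.prod_mul_distrib]
    exact Finset.prod_congr rfl fun j hj => by rw [split, hcol j (hJ hj)]
  have hne : ∏ j ∈ J, ∏ k ∈ J, e j k ≠ 0 :=
    Finset.prod_ne_zero_iff.2 fun j _ => Finset.prod_ne_zero_iff.2 fun k _ h => by
      simpa [h] using he j k
  have h3 := mul_right_cancel₀ hne (h1.trans h2.symm)
  simp_rw [Finset.prod_mul_distrib]
  rw [← h3]
  simp_rw [← Finset.prod_mul_distrib, he, Finset.prod_const_one]

/-- If `e` is as in `prod_separated_signs`, it may be inserted in a product over separated pairs. -/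
lemma prod_separated_eq {ι : Type*} [DecidableEq ι] (I J : Finset ι) (hJ : J ⊆ I) (e G : ι → ι → ℝ) (C : ℝ)
    (he : ∀ j k, e j k * e j k = 1)
    (hrow : ∀ j ∈ I, ∏ k ∈ I, e j k = C) (hcol : ∀ j ∈ I, ∏ k ∈ I, e k j = C) :
    ∏ j ∈ J, ∏ k ∈ I \ J, G j k * G k j =
      ∏ j ∈ J, ∏ k ∈ I \ J, (e j k * G j k) * (e k j * G k j) := by
  have h := prod_separated_signs I J hJ e C he hrow hcol
  rw [← one_mul (∏ j ∈ J, ∏ k ∈ I \ J, G j k * G k j), ← h]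
  simp_rw [← Finset.prod_mul_distrib]
  exact Finset.prod_congr rfl fun j _ => Finset.prod_congr rfl fun k _ => by ring

lemma prod_Icc_natCast_zmod (n : ℕ) [NeZero n] (E : ZMod n → ℝ) :
    ∏ k ∈ Icc 1 n, E (k : ZMod n) = ∏ t, E t := by
  have hinj : Set.InjOn (fun k : ℕ => (k : ZMod n)) (Icc 1 n : Finset ℕ) := by
    intro a ha b hb hab
    simp only [Finset.coe_Icc, Set.mem_Icc] at ha hb
    have h : a ≡ b [MOD n] := (ZMod.natCast_eq_natCast_iff a b n).1 hab
    rcases le_total a b with hle | hle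
    · have := (Nat.modEq_iff_dvd' hle).1 h
      have := Nat.eq_zero_of_dvd_of_lt this (by omega)
      omega
    · have := (Nat.modEq_iff_dvd' hle).1 h.symm
      have := Nat.eq_zero_of_dvd_of_lt this (by omega)
      omega
  refine Finset.prod_nbij (fun k : ℕ => (k : ZMod n)) (fun _ _ => Finset.mem_univ _) hinj
    (Finset.surjOn_of_injOn_of_card_le _ (fun _ _ => Finset.mem_coe.2 (Finset.mem_univ _)) hinj ?_)
    (fun _ _ => rfl)
  simp [ZMod.card]

/-- The angle `b` lies close to `π p / n`, with `s = 1` below and `s = -1` above this value. -/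
def NearAngle (n p q : ℕ) (b s : ℝ) : Prop :=
  (s = 1 ∧ π * ((p : ℝ) / n - 1 / ((n : ℝ) * q)) < b ∧ b < π * ((p : ℝ) / n)) ∨
  (s = -1 ∧ π * ((p : ℝ) / n) < b ∧ b < π * ((p : ℝ) / n + 1 / ((n : ℝ) * ((n : ℝ) - q))))

lemma NearAngle.cleared {n p q : ℕ} {b s : ℝ} (hn : 2 ≤ n) (hq1 : 1 ≤ q) (hqn : q ≤ n - 1)
    (h : NearAngle n p q b s) :
    (s = 1 ∧ (p * q - 1) * π < n * q * b ∧ n * b < p * π) ∨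
    (s = -1 ∧ p * π < n * b ∧ n * (n - q : ℝ) * b < (p * (n - q : ℝ) + 1) * π) := by
  have hn0 : (0 : ℝ) < n := by exact_mod_cast (by omega : 0 < n)
  have hq0 : (0 : ℝ) < q := by exact_mod_cast hq1
  have hnq : (0 : ℝ) < n - q := by
    have : (q : ℝ) < n := by exact_mod_cast (by omega : q < n)
    linarith
  rcases h with ⟨hs, h1, h2⟩ | ⟨hs, h1, h2⟩
  · refine Or.inl ⟨hs, ?_, ?_⟩
    · have := mul_lt_mul_of_pos_left h1 (mul_pos hn0 hq0)
      field_simp at this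
      linarith
    · have := mul_lt_mul_of_pos_left h2 hn0
      field_simp at this
      linarith
  · refine Or.inr ⟨hs, ?_, ?_⟩
    · have := mul_lt_mul_of_pos_left h1 hn0
      field_simp at this
      linarith
    · have := mul_lt_mul_of_pos_left h2 (mul_pos hn0 hnq)
      have e : n * (n - q : ℝ) * (π * ((p : ℝ) / n + 1 / ((n : ℝ) * ((n : ℝ) - q)))) =
          (p * (n - q : ℝ) + 1) * π := by
        field_simp
      linarith

/-- The multiple `m b` lies in the same interval between consecutive multiples of `π`
as `m π p / n`. -/
lemma mul_angle_bounds {n p q : ℕ} {b s : ℝ} (hn : 2 ≤ n) (hq1 : 1 ≤ q) (hqn : q ≤ n - 1)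
    (hpq : (p * q) % n = 1 % n) (h : NearAngle n p q b s) {m : ℕ} (hm1 : 1 ≤ m) (hmn : m < n) :
    ((p * m / n : ℕ) : ℝ) * π < m * b ∧ m * b < ((p * m / n : ℕ) + 1 : ℝ) * π := by
  have hn0 : (0 : ℝ) < n := by exact_mod_cast (by omega : 0 < n)
  have hq0 : (0 : ℝ) < q := by exact_mod_cast hq1
  have hm0 : (0 : ℝ) < m := by exact_mod_cast hm1
  have hnq : (0 : ℝ) < n - q := by
    have : (q : ℝ) < n := by exact_mod_cast (by omega : q < n)
    linarith
  have hπ := Real.pi_pos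
  set N := p * m / n with hN
  set r := p * m % n with hr
  have hdiv : n * N + r = p * m := Nat.div_add_mod _ _
  have hrn : r < n := Nat.mod_lt _ (by omega)
  have hrq : (r * q) % n = m := by
    have e : r * q ≡ m [MOD n] := calc
      r * q ≡ p * m * q [MOD n] := (Nat.mod_modEq _ _).mul_right q
      _ = p * q * m := by ring
      _ ≡ 1 * m [MOD n] := Nat.ModEq.mul_right m hpq
      _ = m := one_mul m
    rw [Nat.mod_eq_of_modEq e hmn]
  have hrq1 : (m : ℝ) ≤ r * q := by exact_mod_cast hrq ▸ Nat.mod_le (r * q) n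
  have hrq2 : (m : ℝ) ≤ (n - r) * (n - q) := by
    have hc : n * (r * q / n) + m = r * q := by rw [← hrq]; exact Nat.div_add_mod _ _
    zify at hc hrn hmn hn hqn
    have hqn' : (q : ℤ) < n := by omega
    have hpos : 0 < ((n : ℤ) - r) * (n - q) := mul_pos (by linarith) (by linarith)
    have key : (m : ℤ) ≤ (n - r) * (n - q) := by
      generalize ((r : ℤ) * q / n) = c at hc
      have e : ((n : ℤ) - r) * (n - q) = m + n * (n - r - q + c) := by linarith
      by_contra hlt
      have : (n : ℤ) * (n - r - q + c) < 0 := by linarith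
      have : (n : ℤ) - r - q + c ≤ -1 := by
        by_contra h'
        have := mul_nonneg (by omega : (0 : ℤ) ≤ n) (by omega : (0 : ℤ) ≤ n - r - q + c)
        linarith
      have := mul_le_mul_of_nonneg_left this (by omega : (0 : ℤ) ≤ n)
      linarith
    exact_mod_cast key
  have hdiv' : (n : ℝ) * N + r = p * m := by exact_mod_cast hdiv
  have hrn' : (r : ℝ) + 1 ≤ n := by exact_mod_cast hrn
  have hr0 : (0 : ℝ) ≤ r := Nat.cast_nonneg r
  rcases h.cleared hn hq1 hqn with ⟨-, h1, h2⟩ | ⟨-, h1, h2⟩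
  · constructor
    · refine lt_of_mul_lt_mul_left ?_ (mul_pos hn0 hq0).le
      have h3 := mul_lt_mul_of_pos_left h1 hm0
      have h4 := mul_le_mul_of_nonneg_right hrq1 hπ.le
      have h5 : (p * m : ℝ) * q * π = (n * N + r) * q * π := by rw [hdiv']
      linarith
    · refine lt_of_mul_lt_mul_left ?_ hn0.le
      have h3 := mul_lt_mul_of_pos_left h2 hm0
      have h4 := mul_lt_mul_of_pos_right (by linarith : (r : ℝ) < n) hπ
      have h5 : (p * m : ℝ) * π = (n * N + r) * π := by rw [hdiv']
      linarith
  · constructor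
    · refine lt_of_mul_lt_mul_left ?_ hn0.le
      have h3 := mul_lt_mul_of_pos_left h1 hm0
      have h4 := mul_nonneg hr0 hπ.le
      have h5 : (p * m : ℝ) * π = (n * N + r) * π := by rw [hdiv']
      linarith
    · refine lt_of_mul_lt_mul_left ?_ (mul_pos hn0 hnq).le
      have h3 := mul_lt_mul_of_pos_left h2 hm0
      have h4 := mul_le_mul_of_nonneg_right hrq2 hπ.le
      have h5 : (p * m : ℝ) * (n - q) * π = (n * N + r) * (n - q) * π := by rw [hdiv']
      linarith

/-- The bounds of `mul_angle_bounds` persist after adding a part of the total `p π - n b`. -/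
lemma mul_angle_add_bounds {n p q : ℕ} {b s : ℝ} (hn : 2 ≤ n) (hq1 : 1 ≤ q) (hqn : q ≤ n - 1)
    (hpq : (p * q) % n = 1 % n) (h : NearAngle n p q b s) {m : ℕ} (hm1 : 1 ≤ m) (hmn : m < n)
    {S : ℝ} (hS0 : 0 ≤ s * S) (hS1 : s * S ≤ s * (p * π - n * b)) :
    ((p * m / n : ℕ) : ℝ) * π < m * b + S ∧ m * b + S < ((p * m / n : ℕ) + 1 : ℝ) * π := by
  obtain ⟨h1, h2⟩ := mul_angle_bounds hn hq1 hqn hpq h hm1 hmn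
  obtain ⟨h3, h4⟩ := mul_angle_bounds hn hq1 hqn hpq h (m := n - m) (by omega) (by omega)
  have hr : 0 < p * m % n := by
    rcases Nat.eq_zero_or_pos (p * m % n) with h0 | h0
    · exfalso
      have e : m ≡ 0 [MOD n] := calc
        m = 1 * m := (one_mul m).symm
        _ ≡ p * q * m [MOD n] := Nat.ModEq.mul_right m (Eq.symm hpq)
        _ = p * m * q := by ring
        _ ≡ 0 * q [MOD n] := Nat.ModEq.mul_right q (by simpa [Nat.ModEq] using h0)
        _ = 0 := zero_mul q
      have := Nat.eq_zero_of_dvd_of_lt ((Nat.modEq_zero_iff_dvd).1 e) hmn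
      omega
    · exact h0
  have hsum : p * (n - m) / n + p * m / n + 1 = p := by
    have hrn : p * m % n < n := Nat.mod_lt _ (by omega)
    have hd := Nat.div_add_mod (p * m) n
    have hd' := Nat.div_add_mod (p * (n - m)) n
    have hrn' : p * (n - m) % n < n := Nat.mod_lt _ (by omega)
    have ht : p * (n - m) + p * m = p * n := by rw [← mul_add, Nat.sub_add_cancel hmn.le]
    generalize p * (n - m) / n = A at *
    generalize p * m / n = B at *
    generalize p * m % n = r at *
    generalize p * (n - m) % n = r' at *
    have e : n * (A + B) + (r + r') = n * p := by linarith
    have lo : n * (A + B) < n * p := by omega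
    have hi : n * p < n * (A + B + 2) := by
      have : n * (A + B + 2) = n * (A + B) + 2 * n := by ring
      omega
    have := lt_of_mul_lt_mul_left lo (Nat.zero_le n)
    have := lt_of_mul_lt_mul_left hi (Nat.zero_le n)
    omega
  have hsum' : ((p * (n - m) / n : ℕ) : ℝ) + (p * m / n : ℕ) + 1 = p := by exact_mod_cast hsum
  have hsumπ : (((p * (n - m) / n : ℕ) : ℝ) + (p * m / n : ℕ) + 1) * π = p * π := by rw [hsum']
  rw [Nat.cast_sub hmn.le] at h3 h4
  rcases h with ⟨rfl, -⟩ | ⟨rfl, -⟩ <;> constructor <;> linarith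

/-- The sign of `sin (m b + S + b) / sin (m b + S)` depends only on `m`. -/
lemma exists_sign_sin_ratio {n p q : ℕ} {b s : ℝ} (hn : 2 ≤ n) (hp1 : 1 ≤ p) (hq1 : 1 ≤ q)
    (hqn : q ≤ n - 1) (hpq : (p * q) % n = 1 % n) (h : NearAngle n p q b s) (m : ℕ) :
    ∃ e : ℝ, e * e = 1 ∧ (1 ≤ m → m < n → ∀ S : ℝ,
      (0 ≤ s * S → s * S ≤ s * (p * π - n * b) →
        0 ≤ e * (Real.sin (m * b + S + b) / Real.sin (m * b + S))) ∧
      (0 < s * S → s * S < s * (p * π - n * b) →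
        0 < e * (Real.sin (m * b + S + b) / Real.sin (m * b + S)))) := by
  suffices H : ∃ N' : ℕ, 1 ≤ m → m < n → ∀ S : ℝ,
      (0 ≤ s * S → s * S ≤ s * (p * π - n * b) →
        N' * π ≤ m * b + S + b ∧ m * b + S + b ≤ (N' + 1) * π) ∧
      (0 < s * S → s * S < s * (p * π - n * b) →
        N' * π < m * b + S + b ∧ m * b + S + b < (N' + 1) * π) by
    obtain ⟨N', hN'⟩ := H
    have hsq : ∀ k : ℕ, ((-1 : ℝ) ^ k) * (-1) ^ k = 1 := fun k => by
      rw [← mul_pow]; norm_num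
    have hratio : ∀ N : ℕ, ∀ x y : ℝ,
        (-1) ^ N' * (-1) ^ N * (x / y) = ((-1) ^ N' * x) / ((-1) ^ N * y) := fun N x y => by
      rcases neg_one_pow_eq_or ℝ N with h | h <;> simp [h, div_neg, mul_div_assoc]
    refine ⟨(-1) ^ N' * (-1) ^ (p * m / n), by
      rw [mul_mul_mul_comm, hsq, hsq, one_mul], ?_⟩
    intro hm1 hmn S
    refine ⟨fun h0 h1 => ?_, fun h0 h1 => ?_⟩
    · obtain ⟨a1, a2⟩ := mul_angle_add_bounds hn hq1 hqn hpq h hm1 hmn h0 h1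
      obtain ⟨c1, c2⟩ := (hN' hm1 hmn S).1 h0 h1
      rw [hratio]
      exact div_nonneg (neg_one_pow_mul_sin_nonneg _ c1 c2) (neg_one_pow_mul_sin_pos _ a1 a2).le
    · obtain ⟨a1, a2⟩ := mul_angle_add_bounds hn hq1 hqn hpq h hm1 hmn h0.le h1.le
      obtain ⟨c1, c2⟩ := (hN' hm1 hmn S).2 h0 h1
      rw [hratio]
      exact div_pos (neg_one_pow_mul_sin_pos _ c1 c2) (neg_one_pow_mul_sin_pos _ a1 a2)
  have hπ := Real.pi_pos
  rcases Nat.lt_trichotomy (m + 1) n with hlt | heq | hgt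
  · refine ⟨p * (m + 1) / n, fun hm1 hmn S => ?_⟩
    have key : 0 ≤ s * S → s * S ≤ s * (p * π - n * b) →
        ((p * (m + 1) / n : ℕ) : ℝ) * π < m * b + S + b ∧
          m * b + S + b < ((p * (m + 1) / n : ℕ) + 1 : ℝ) * π := fun h0 h1 => by
      have := mul_angle_add_bounds hn hq1 hqn hpq h (m := m + 1) (by omega) hlt h0 h1
      push_cast at this
      constructor <;> linarith [this.1, this.2]
    exact ⟨fun h0 h1 => ⟨(key h0 h1).1.le, (key h0 h1).2.le⟩, fun h0 h1 => key h0.le h1.le⟩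
  · have hmn' : (m : ℝ) + 1 = n := by exact_mod_cast heq
    have hmb : (m : ℝ) * b + b = n * b := by rw [← hmn']; ring
    have hq0 : (1 : ℝ) ≤ q := by exact_mod_cast hq1
    have hnq : (1 : ℝ) ≤ n - q := by
      have : (q : ℝ) + 1 ≤ n := by exact_mod_cast (by omega : q + 1 ≤ n)
      linarith
    rcases h.cleared hn hq1 hqn with ⟨rfl, h1, h2⟩ | ⟨rfl, h1, h2⟩
    · have hlow : (p - 1) * π < n * b := by
        refine lt_of_mul_lt_mul_left (a := (q : ℝ)) ?_ (by linarith)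
        nlinarith
      refine ⟨p - 1, fun _ _ S => ?_⟩
      rw [Nat.cast_sub hp1]
      push_cast
      refine ⟨fun h0 h1 => ⟨?_, ?_⟩, fun h0 h1 => ⟨?_, ?_⟩⟩ <;> linarith
    · have hupp : n * b < (p + 1) * π := by
        refine lt_of_mul_lt_mul_left (a := (n - q : ℝ)) ?_ (by linarith)
        nlinarith
      refine ⟨p, fun _ _ S => ?_⟩
      refine ⟨fun h0 h1 => ⟨?_, ?_⟩, fun h0 h1 => ⟨?_, ?_⟩⟩ <;> linarith
  · exact ⟨0, fun _ hmn => by omega⟩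

lemma coord_of_mod_eq {n : ℕ} (hn : 0 < n) (α : ℝ) (x : Fin n → ℝ) {i k : ℕ} (hi : 1 ≤ i)
    (hk : k ∈ Icc 1 n) (h : i ≡ k [MOD n]) :
    coord α x i = coord α x k - 2 * π / α * ((i - 1) / n : ℕ) := by
  obtain ⟨hk1, hkn⟩ := Finset.mem_Icc.1 hk
  have h' : (i - 1) % n = (k - 1) % n :=
    Nat.ModEq.add_right_cancel' 1 (by rwa [Nat.sub_add_cancel hi, Nat.sub_add_cancel hk1])
  have h0 : (k - 1) / n = 0 := Nat.div_eq_of_lt (by omega)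
  simp [coord, hn, h', h0]

lemma coord_add_mul {n : ℕ} (hn : 0 < n) (α : ℝ) (x : Fin n → ℝ) {i : ℕ} (hi : 1 ≤ i) (l : ℕ) :
    coord α x (i + n * l) = coord α x i - 2 * π / α * l := by
  have h1 : i + n * l - 1 = i - 1 + n * l := by omega
  simp only [coord, hn, dif_pos, h1, Nat.add_mul_mod_self_left, Nat.add_mul_div_left _ _ hn]
  push_cast
  ring

lemma coord_neg {n : ℕ} (α : ℝ) (x : Fin n → ℝ) {j : ℕ} (hj : j ∈ Icc 1 n) :
    coord α (-x) j = -coord α x j := by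
  obtain ⟨hj1, hjn⟩ := Finset.mem_Icc.1 hj
  have h0 : (j - 1) / n = 0 := Nat.div_eq_of_lt (by omega)
  have hn : 0 < n := by omega
  simp [coord, hn, h0]

/-- The ratio of sines attached to the ordered pair `(j, k)`. -/
def pairRatio {n : ℕ} (α g : ℝ) (x : Fin n → ℝ) (j k : ℕ) : ℝ :=
  Real.sin (α * (coord α x j - coord α x k + g) / 2) /
    Real.sin (α * (coord α x j - coord α x k) / 2)

lemma VJ_mul_VJ_neg {n : ℕ} (α g : ℝ) (J : Finset ℕ) (hJ : J ⊆ Icc 1 n) (x : Fin n → ℝ) :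
    VJ n α g J x * VJ n α g J (-x) =
      ∏ j ∈ J, ∏ k ∈ Icc 1 n \ J, pairRatio α g x j k * pairRatio α g x k j := by
  unfold VJ
  rw [← Finset.prod_mul_distrib]
  refine Finset.prod_congr rfl fun j hj => ?_
  rw [← Finset.prod_mul_distrib]
  refine Finset.prod_congr rfl fun k hk => ?_
  rw [coord_neg α x (hJ hj), coord_neg α x (Finset.mem_sdiff.1 hk).1]
  have h : -coord α x j - -coord α x k = coord α x k - coord α x j := by ring
  rw [h]
  rfl

/-- The deviation of `x_i - x_{i+p}` from `g`. -/
def gap {n : ℕ} (p : ℕ) (α g : ℝ) (x : Fin n → ℝ) (i : ℕ) : ℝ :=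
  coord α x i - coord α x (i + p) - g

lemma exists_gap_eq {n : ℕ} (hn : 0 < n) (p : ℕ) (α g : ℝ) (x : Fin n → ℝ) {i : ℕ}
    (hi : 1 ≤ i) : ∃ j ∈ Icc 1 n, gap p α g x i = gap p α g x j := by
  refine ⟨(i - 1) % n + 1, ?_, ?_⟩
  · have := Nat.mod_lt (i - 1) hn
    exact Finset.mem_Icc.2 ⟨by omega, by omega⟩
  · have hd := Nat.mod_add_div (i - 1) n
    have e : i = (i - 1) % n + 1 + n * ((i - 1) / n) := by omega
    have e' : i + p = (i - 1) % n + 1 + p + n * ((i - 1) / n) := by omega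
    have h1 := coord_add_mul hn α x (i := (i - 1) % n + 1) (by omega) ((i - 1) / n)
    have h2 := coord_add_mul hn α x (i := (i - 1) % n + 1 + p) (by omega) ((i - 1) / n)
    rw [← e] at h1
    rw [← e'] at h2
    unfold gap
    rw [h1, h2]
    ring

lemma sum_gap {n : ℕ} (p : ℕ) (α g : ℝ) (x : Fin n → ℝ) (j m : ℕ) :
    ∑ l ∈ range m, gap p α g x (j + p * l) = coord α x j - coord α x (j + p * m) - m * g := by
  induction m with
  | zero => simp
  | succ m ih =>
    rw [Finset.sum_range_succ, ih, gap, add_assoc j, ← Nat.mul_succ]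
    push_cast
    ring

lemma sum_gap_total {n : ℕ} (hn : 0 < n) (p : ℕ) (α g : ℝ) (x : Fin n → ℝ) {j : ℕ} (hj : 1 ≤ j) :
    ∑ l ∈ range n, gap p α g x (j + p * l) = 2 * π / α * p - n * g := by
  rw [sum_gap, mul_comm p n, coord_add_mul hn α x hj]
  ring

lemma pairRatio_eq {n : ℕ} (hn : 0 < n) (p : ℕ) {α : ℝ} (hα : 0 < α) (g : ℝ) (x : Fin n → ℝ)
    {j k : ℕ} (hj : 1 ≤ j) (hk : k ∈ Icc 1 n) (m : ℕ) (h : j + p * m ≡ k [MOD n]) :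
    pairRatio α g x j k =
      Real.sin (m * (α / 2 * g) + α / 2 * ∑ l ∈ range m, gap p α g x (j + p * l) + α / 2 * g) /
        Real.sin (m * (α / 2 * g) + α / 2 * ∑ l ∈ range m, gap p α g x (j + p * l)) := by
  have hc := coord_of_mod_eq hn α x (i := j + p * m) (by omega) hk h
  rw [sum_gap, hc]
  set l := (j + p * m - 1) / n
  have e1 : m * (α / 2 * g) + α / 2 *
      (coord α x j - (coord α x k - 2 * π / α * l) - m * g) + α / 2 * g =
      α * (coord α x j - coord α x k + g) / 2 + l * π := by
    field_simp
    ring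
  have e2 : m * (α / 2 * g) + α / 2 *
      (coord α x j - (coord α x k - 2 * π / α * l) - m * g) =
      α * (coord α x j - coord α x k) / 2 + l * π := by
    field_simp
    ring
  rw [e1, e2, Real.sin_add_nat_mul_pi, Real.sin_add_nat_mul_pi,
    mul_div_mul_left _ _ (pow_ne_zero _ (by norm_num))]
  rfl

lemma TypeI.nearAngle {n p q : ℕ} {α g : ℝ} (hn : 2 ≤ n) (hα : 0 < α) (h : TypeI n p q α g) :
    NearAngle n p q (α / 2 * g) (Real.sign (2 * π * p / α - n * g)) := by
  have hn0 : (0 : ℝ) < n := by exact_mod_cast (by omega : 0 < n)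
  have hα2 : 0 < α / 2 := by linarith
  have hmul : ∀ y : ℝ, α / 2 * (2 * π / α * y) = π * y := fun y => by field_simp
  have hM : n * (2 * π / α * ((p : ℝ) / n)) = 2 * π * p / α := by field_simp
  obtain ⟨-, -, -, ⟨h1, h2⟩ | ⟨h1, h2⟩⟩ := h
  · left
    have hs := mul_lt_mul_of_pos_left h2 hn0
    refine ⟨Real.sign_of_pos (by linarith), ?_, ?_⟩ <;> rw [← hmul] <;> gcongr
  · right
    have hs := mul_lt_mul_of_pos_left h1 hn0
    refine ⟨Real.sign_of_neg (by linarith), ?_, ?_⟩ <;> rw [← hmul] <;> gcongr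


/-- for a type (i) coupling, `V_J(g;x)·V_J(g;-x) ≥ 0` on `Σ̄_{g,p}`, with
strict inequality on the interior `Σ_{g,p}`. -/
theorem statement5 (n p q : ℕ) (α g : ℝ)
    (hn : 2 ≤ n) (hα : 0 < α) (hp1 : 1 ≤ p) (hpn : p ≤ n - 1) (hcop : Nat.Coprime p n)
    (htype : TypeI n p q α g)
    (J : Finset ℕ) (hJ : J ⊆ Icc 1 n) :
    (∀ x ∈ SigmaBar n p α g, 0 ≤ VJ n α g J x * VJ n α g J (-x)) ∧
    (∀ x ∈ SigmaInt n p α g, 0 < VJ n α g J x * VJ n α g J (-x)) := by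
  obtain ⟨hq1, hqn, hpq, -⟩ := id htype
  have hn0 : 0 < n := by omega
  have : NeZero n := ⟨by omega⟩
  have hα2 : 0 < α / 2 := by linarith
  have hnear := htype.nearAngle hn hα
  set s := Real.sign (2 * π * p / α - n * g)
  choose e he hsign using exists_sign_sin_ratio hn hp1 hq1 hqn hpq hnear
  let E : ZMod n → ℝ := fun t => e ((q : ZMod n) * t).val
  let ε : ℕ → ℕ → ℝ := fun j k => E ((k : ZMod n) - j)
  have hrow : ∀ j ∈ Icc 1 n, ∏ k ∈ Icc 1 n, ε j k = ∏ t, E t := fun j _ => by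
    rw [prod_Icc_natCast_zmod n fun t => E (t - j)]
    exact (Equiv.subRight (j : ZMod n)).prod_comp E
  have hcol : ∀ j ∈ Icc 1 n, ∏ k ∈ Icc 1 n, ε k j = ∏ t, E t := fun j _ => by
    rw [prod_Icc_natCast_zmod n fun t => E (j - t)]
    exact (Equiv.subLeft (j : ZMod n)).prod_comp E
  have hprod : ∀ x : Fin n → ℝ, VJ n α g J x * VJ n α g J (-x) =
      ∏ j ∈ J, ∏ k ∈ Icc 1 n \ J,
        (ε j k * pairRatio α g x j k) * (ε k j * pairRatio α g x k j) := fun x => by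
    rw [VJ_mul_VJ_neg α g J hJ x]
    exact prod_separated_eq _ J hJ ε _ _ (fun _ _ => he _) hrow hcol
  have hpq' : (p : ZMod n) * q = 1 := by
    have := (ZMod.natCast_eq_natCast_iff (p * q) 1 n).2 hpq
    push_cast at this
    exact this
  -- the number of steps of length `p` leading from `j` to `k`
  have hstep : ∀ j ∈ Icc 1 n, ∀ k ∈ Icc 1 n, j ≠ k → ∃ m : ℕ, 1 ≤ m ∧ m < n ∧
      j + p * m ≡ k [MOD n] ∧ ε j k = e m := by
    intro j hj k hk hjk
    have hmod : j + p * ((q : ZMod n) * ((k : ZMod n) - j)).val ≡ k [MOD n] := by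
      rw [← ZMod.natCast_eq_natCast_iff]
      push_cast
      rw [ZMod.natCast_zmod_val, ← mul_assoc, hpq']
      ring
    refine ⟨((q : ZMod n) * ((k : ZMod n) - j)).val, ?_, ZMod.val_lt _, hmod, rfl⟩
    by_contra h0
    rw [Nat.lt_one_iff.1 (not_le.1 h0), mul_zero, add_zero] at hmod
    obtain ⟨hj1, hjn⟩ := Finset.mem_Icc.1 hj
    obtain ⟨hk1, hkn⟩ := Finset.mem_Icc.1 hk
    rcases le_total j k with hle | hle
    · have := Nat.eq_zero_of_dvd_of_lt ((Nat.modEq_iff_dvd' hle).1 hmod) (by omega)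
      omega
    · have := Nat.eq_zero_of_dvd_of_lt ((Nat.modEq_iff_dvd' hle).1 hmod.symm) (by omega)
      omega
  have htot : ∀ x : Fin n → ℝ, ∀ j, 1 ≤ j → ∀ m ≤ n,
      s * (α / 2 * ∑ l ∈ range m, gap p α g x (j + p * l)) =
        α / 2 * ∑ l ∈ range m, s * gap p α g x (j + p * l) ∧
      s * (p * π - n * (α / 2 * g)) - s * (α / 2 * ∑ l ∈ range m, gap p α g x (j + p * l)) =
        α / 2 * ∑ l ∈ Ico m n, s * gap p α g x (j + p * l) := by
    intro x j hj m hm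
    refine ⟨by rw [← Finset.mul_sum]; ring, ?_⟩
    have h1 := sum_gap_total hn0 p α g x hj
    have h2 : p * π - n * (α / 2 * g) = α / 2 * (2 * π / α * p - n * g) := by
      field_simp
    rw [h2, ← h1, ← Finset.sum_range_add_sum_Ico _ hm, ← Finset.mul_sum]
    ring
  have hnonneg : ∀ x ∈ SigmaBar n p α g, ∀ j ∈ Icc 1 n, ∀ k ∈ Icc 1 n, j ≠ k →
      0 ≤ ε j k * pairRatio α g x j k := by
    intro x hx j hj k hk hjk
    obtain ⟨m, hm1, hmn, hmod, hε⟩ := hstep j hj k hk hjk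
    have hj1 := (Finset.mem_Icc.1 hj).1
    have hgap : ∀ l, 0 ≤ s * gap p α g x (j + p * l) := fun l => by
      obtain ⟨i, hi, h⟩ := exists_gap_eq hn0 p α g x (i := j + p * l) (by omega)
      rw [h]
      exact hx.2 i hi
    obtain ⟨h1, h2⟩ := htot x j hj1 m hmn.le
    rw [hε, pairRatio_eq hn0 p hα g x hj1 hk m hmod]
    refine (hsign m hm1 hmn _).1 ?_ ?_
    · rw [h1]
      exact mul_nonneg hα2.le (Finset.sum_nonneg fun l _ => hgap l)
    · rw [← sub_nonneg, h2]
      exact mul_nonneg hα2.le (Finset.sum_nonneg fun l _ => hgap l)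
  have hpos : ∀ x ∈ SigmaInt n p α g, ∀ j ∈ Icc 1 n, ∀ k ∈ Icc 1 n, j ≠ k →
      0 < ε j k * pairRatio α g x j k := by
    intro x hx j hj k hk hjk
    obtain ⟨m, hm1, hmn, hmod, hε⟩ := hstep j hj k hk hjk
    have hj1 := (Finset.mem_Icc.1 hj).1
    have hgap : ∀ l, 0 < s * gap p α g x (j + p * l) := fun l => by
      obtain ⟨i, hi, h⟩ := exists_gap_eq hn0 p α g x (i := j + p * l) (by omega)
      rw [h]
      exact hx.2 i hi
    obtain ⟨h1, h2⟩ := htot x j hj1 m hmn.le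
    rw [hε, pairRatio_eq hn0 p hα g x hj1 hk m hmod]
    refine (hsign m hm1 hmn _).2 ?_ ?_
    · rw [h1]
      exact mul_pos hα2 (Finset.sum_pos (fun l _ => hgap l) ⟨0, Finset.mem_range.2 hm1⟩)
    · rw [← sub_pos, h2]
      exact mul_pos hα2 (Finset.sum_pos (fun l _ => hgap l) ⟨m, Finset.mem_Ico.2 ⟨le_rfl, hmn⟩⟩)
  have hne : ∀ j ∈ J, ∀ k ∈ Icc 1 n \ J, k ∈ Icc 1 n ∧ j ≠ k := fun j hj k hk =>
    ⟨(Finset.mem_sdiff.1 hk).1, fun h => (Finset.mem_sdiff.1 hk).2 (h ▸ hj)⟩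
  refine ⟨fun x hx => ?_, fun x hx => ?_⟩
  · rw [hprod]
    refine Finset.prod_nonneg fun j hj => Finset.prod_nonneg fun k hk => ?_
    obtain ⟨hk', hjk⟩ := hne j hj k hk
    exact mul_nonneg (hnonneg x hx j (hJ hj) k hk' hjk) (hnonneg x hx k hk' j (hJ hj) hjk.symm)
  · rw [hprod]
    refine Finset.prod_pos fun j hj => Finset.prod_pos fun k hk => ?_
    obtain ⟨hk', hjk⟩ := hne j hj k hk
    exact mul_pos (hpos x hx j (hJ hj) k hk' hjk) (hpos x hx k hk' j (hJ hj) hjk.symm)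
end
end

section
/- Let n ≥ 2 be an integer, α > 0, p ∈ {1,…,n−1} coprime to n, and let g be a type (i) coupling satisfying the quantisation condition M ∈ ℤ ∖ {0}. Then for every r ∈ {1,…,n−1}, every ν ∈ S_n(ω_r), and every μ ∈ Λ⁺_{p,|M|} with μ+ν ∈ Λ⁺_{p,|M|}: all sine denominators occurring in V_ν(g; ρ_p+sgn(M)μ) and in V_ν(g; −ρ_p−sgn(M)(μ+ν)) are nonzero, and the product V_ν(g; ρ_p+sgn(M)μ) · V_ν(g; −ρ_p−sgn(M)(μ+ν)) is strictly positive. -/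
noncomputable section
open Real Finset
open scoped Classical

/-! ### Signs of the sine factors -/

/-- If `p * q ≡ 1 (mod n)`, then `k` is bounded by `q * (k * p % n)` for `0 < k < n`, and similarly
with `p` or `q` replaced by their negatives modulo `n`. -/
lemma mul_mod_inverse_bounds {n p q k : ℕ} (hq1 : 1 ≤ q) (hqn : q < n)
    (hpq : (p * q) % n = 1 % n) (hk0 : 0 < k) (hkn : k < n) :
    0 < k * p % n ∧ k ≤ q * (k * p % n) ∧ n - k ≤ q * (n - k * p % n) ∧
      n - k ≤ (n - q) * (k * p % n) ∧ k ≤ (n - q) * (n - k * p % n) := by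
  have hb : k * p % n < n := Nat.mod_lt _ (by omega)
  have hdiv := Nat.div_add_mod (k * p) n
  set b := k * p % n
  set a := k * p / n
  obtain ⟨t, ht⟩ : (n : ℤ) ∣ p * q - 1 := by
    have h : (p * q) ≡ 1 [MOD n] := hpq
    have := (Nat.modEq_iff_dvd.1 h.symm)
    exact_mod_cast this
  have hdiv' : (n : ℤ) * a + b = k * p := by exact_mod_cast hdiv
  have key : (n : ℤ) ∣ q * b - k := ⟨k * t - q * a, by linear_combination q * hdiv' + k * ht⟩
  have nonneg_of_dvd : ∀ z : ℤ, (n : ℤ) ∣ z → -n < z → 0 ≤ z := by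
    rintro z ⟨w, rfl⟩ hz
    have : -1 < w := by
      by_contra! h
      nlinarith
    exact mul_nonneg (by omega) (by omega)
  have hqb : (0 : ℤ) ≤ q * b := by positivity
  have hqb' : (0 : ℤ) ≤ q * (n - b) := mul_nonneg (by omega) (by omega)
  have hqb2 : (0 : ℤ) ≤ (n - q) * b := mul_nonneg (by omega) (by omega)
  have hqb3 : (0 : ℤ) ≤ (n - q) * (n - b) := mul_nonneg (by omega) (by omega)
  obtain ⟨w, hw⟩ := key
  have h1 := nonneg_of_dvd (q * b - k) ⟨w, hw⟩ (by omega)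
  have h2 := nonneg_of_dvd (q * (n - b) - (n - k)) ⟨q - 1 - w, by linear_combination -hw⟩ (by omega)
  have h3 := nonneg_of_dvd ((n - q) * b - (n - k)) ⟨b - 1 - w, by linear_combination -hw⟩ (by omega)
  have h4 := nonneg_of_dvd ((n - q) * (n - b) - k) ⟨n - q - b + w, by linear_combination hw⟩
    (by omega)
  refine ⟨?_, ?_, ?_, ?_, ?_⟩
  · rcases Nat.eq_zero_or_pos b with h | h
    · rw [h] at h1
      omega
    · exact h
  all_goals
    zify [hb.le, hkn.le, hqn.le]
    linarith

/-- The sign of `sin (α * (k * g + s * S) / 2)` for a type (i) coupling `g`, where `s = sgn M` and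
`0 ≤ S ≤ |M|`. -/
def sineSign (n p : ℕ) (s : ℝ) (k : ℕ) : ℝ :=
  if k = 0 then s else if k = n then -s * (-1) ^ p else (-1) ^ (k * p / n)

lemma sineSign_mul_self {n p : ℕ} {s : ℝ} (hs : s = 1 ∨ s = -1) (k : ℕ) :
    sineSign n p s k * sineSign n p s k = 1 := by
  have h1 : ∀ a : ℕ, (-1 : ℝ) ^ a * (-1) ^ a = 1 := fun a => by
    rw [← mul_pow]; simp
  have hs' : s * s = 1 := by rcases hs with rfl | rfl <;> norm_num
  unfold sineSign
  split_ifs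
  · exact hs'
  · linear_combination ((-1 : ℝ) ^ p * (-1) ^ p) * hs' + h1 p
  · exact h1 _

lemma sineSign_reflect {n p k : ℕ} {s : ℝ} (hs : s = 1 ∨ s = -1) (hn : 2 ≤ n)
    (hcop : Nat.Coprime p n) (hk : k ≤ n) :
    sineSign n p s k * sineSign n p s (n - k) = (-1) ^ (p + 1) := by
  have hs' : s * s = 1 := by rcases hs with rfl | rfl <;> norm_num
  unfold sineSign
  rcases Nat.eq_zero_or_pos k with rfl | hk0
  · rw [if_pos rfl, if_neg (by omega), if_pos (by omega), pow_succ]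
    linear_combination -(-1 : ℝ) ^ p * hs'
  rcases hk.eq_or_lt with rfl | hkn
  · rw [if_neg (by omega), if_pos rfl, if_pos (by omega), pow_succ]
    linear_combination -(-1 : ℝ) ^ p * hs'
  rw [if_neg (by omega), if_neg (by omega), if_neg (by omega), if_neg (by omega), ← pow_add]
  have hb : 0 < k * p % n := by
    rcases Nat.eq_zero_or_pos (k * p % n) with h | h
    · have := Nat.le_of_dvd hk0 (hcop.symm.dvd_of_dvd_mul_right (Nat.dvd_of_mod_eq_zero h))
      omega
    · exact h
  have hb' : k * p % n < n := Nat.mod_lt _ (by omega)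
  have hdiv := Nat.div_add_mod (k * p) n
  have hle : k * p / n < p := by
    rw [Nat.div_lt_iff_lt_mul (by omega), mul_comm]
    have : 0 < p := by
      by_contra! h
      simp [show p = 0 by omega] at hb
    gcongr
  have : (n - k) * p / n = p - 1 - k * p / n := by
    set b := k * p % n
    set a := k * p / n
    obtain ⟨e, he⟩ : ∃ e, p = a + 1 + e := ⟨p - a - 1, by omega⟩
    have : (n - k) * p = (n - b) + n * e := by
      zify [hkn.le, hb'.le] at hdiv he ⊢
      linear_combination hdiv + n * he
    rw [this, Nat.add_mul_div_left _ _ (by omega), Nat.div_eq_of_lt (by omega)]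
    omega
  rw [this, show p + 1 = k * p / n + (p - 1 - k * p / n) + 2 by omega, pow_add _ _ 2]
  simp

/-- The product of the signs of the two numerators belonging to a root of
height `k` is invariant under `k ↦ n - k`. -/
lemma sineSign_neighbours_reflect {n p k : ℕ} {s : ℝ} (hs : s = 1 ∨ s = -1) (hn : 2 ≤ n)
    (hcop : Nat.Coprime p n) (hk0 : 0 < k) (hk : k < n) :
    sineSign n p s (n - k + 1) * sineSign n p s (n - k - 1) =
      sineSign n p s (k + 1) * sineSign n p s (k - 1) := by
  have h1 := sineSign_reflect hs hn hcop (show k + 1 ≤ n by omega)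
  have h2 := sineSign_reflect hs hn hcop (show k - 1 ≤ n by omega)
  rw [show n - (k + 1) = n - k - 1 by omega] at h1
  rw [show n - (k - 1) = n - k + 1 by omega] at h2
  have e1 := sineSign_mul_self (n := n) (p := p) hs (k + 1)
  have e2 := sineSign_mul_self (n := n) (p := p) hs (k - 1)
  have h3 : ((-1 : ℝ) ^ (p + 1)) * (-1) ^ (p + 1) = 1 := by rw [← mul_pow]; simp
  set A := sineSign n p s (k + 1)
  set B := sineSign n p s (k - 1)
  set C := sineSign n p s (n - k - 1)
  set D := sineSign n p s (n - k + 1)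
  calc D * C = (A * A) * (B * B) * (D * C) := by rw [e1, e2]; ring
    _ = A * B * ((A * C) * (B * D)) := by ring
    _ = A * B := by rw [h1, h2, h3, mul_one]

lemma sineSign_mul_sin_pos {n p q : ℕ} {α g s N : ℝ} (hn : 2 ≤ n) (hα : 0 < α)
    (hq1 : 1 ≤ q) (hqn : q < n) (hpq : (p * q) % n = 1 % n)
    (hM : 2 * π / α * p - n * g = s * N) (hN : 0 < N)
    (hs : (s = 1 ∧ N * q < 2 * π / α) ∨ (s = -1 ∧ N * (n - q) < 2 * π / α))
    {k : ℕ} (hk : k ≤ n) {S : ℝ} (hS0 : 0 ≤ S) (hSN : S ≤ N)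
    (h0 : k = 0 → 0 < S) (h1 : k = n → S < N) :
    0 < sineSign n p s k * sin (α * (k * g + s * S) / 2) := by
  have hqR : (1 : ℝ) ≤ q := by exact_mod_cast hq1
  have hqnR : (q : ℝ) + 1 ≤ n := by exact_mod_cast hqn
  have hnR : (2 : ℝ) ≤ n := by exact_mod_cast hn
  have hc : 0 < 2 * π / α := by positivity
  have hαc : α * (2 * π / α) = 2 * π := by field_simp
  set c := 2 * π / α
  have hNc : N < c := by rcases hs with ⟨-, h⟩ | ⟨-, h⟩ <;> nlinarith
  have hss : s * s = 1 := by rcases hs with ⟨rfl, -⟩ | ⟨rfl, -⟩ <;> norm_num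
  have small : ∀ T, 0 < T → T ≤ N → 0 < s * sin (s * (α * T / 2)) := by
    intro T hT hTN
    have : 0 < sin (α * T / 2) := by
      apply sin_pos_of_pos_of_lt_pi (by positivity)
      nlinarith
    rcases hs with ⟨rfl, -⟩ | ⟨rfl, -⟩
    · simpa using this
    · simpa using this
  unfold sineSign
  split_ifs with hk0 hkn
  · subst hk0
    have := small S (h0 rfl) hSN
    convert this using 3
    push_cast; ring
  · subst hkn
    have := small (N - S) (by linarith [h1 rfl]) (by linarith)
    have e : α * (k * g + s * S) / 2 = -(s * (α * (N - S) / 2)) + p * π := by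
      linear_combination -(α / 2) * hM + p / 2 * hαc
    rw [e, sin_add_nat_mul_pi, sin_neg]
    have h3 : ((-1 : ℝ) ^ p) * (-1) ^ p = 1 := by rw [← mul_pow]; simp
    convert this using 1
    linear_combination s * sin (s * (α * (N - S) / 2)) * h3
  · obtain ⟨hb, b1, b2, b3, b4⟩ := mul_mod_inverse_bounds hq1 hqn hpq (by omega : 0 < k)
      (by omega : k < n)
    have hbn : k * p % n < n := Nat.mod_lt _ (by omega)
    have hdiv := Nat.div_add_mod (k * p) n
    set b := k * p % n
    set a := k * p / n
    have hkn' : k < n := by omega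
    rify [hbn.le, hkn'.le, hqn.le] at b1 b2 b3 b4 hb hbn hkn' hdiv
    set u : ℝ := b / n + s * (S - k * N / n) / c with hu
    have hu' : n * c * u = b * c + s * (n * S - k * N) := by
      rw [hu]; field_simp
    have hnc : 0 < n * c := by positivity
    have e : α * (k * g + s * S) / 2 = u * π + a * π := by
      have : n * c * (α * (k * g + s * S) / 2) = n * c * (u * π + a * π) := by
        linear_combination -c * α * k / 2 * hM - c * π * hdiv - π * hu' +
          (n * s * S / 2 - s * N * k / 2 + c * p * k / 2) * hαc
      exact mul_left_cancel₀ hnc.ne' this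
    have hkR : (0 : ℝ) ≤ k := by positivity
    have bounds : 0 < n * c * u ∧ n * c * u < n * c * 1 := by
      rw [hu']
      have nS : n * S ≤ n * N := by gcongr
      have nS0 : 0 ≤ n * S := by positivity
      rcases hs with ⟨rfl, h⟩ | ⟨rfl, h⟩
      · have i1 : k * N ≤ q * b * N := by gcongr
        have i2 : b * (N * q) < b * c := by gcongr
        have i3 : (n - k) * N ≤ q * (n - b) * N := by gcongr
        have i4 : (n - b) * (N * q) < (n - b) * c := by
          apply mul_lt_mul_of_pos_left h; linarith
        constructor <;> linarith
      · have i1 : (n - k) * N ≤ (n - q) * b * N := by gcongr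
        have i2 : b * (N * (n - q)) < b * c := by gcongr
        have i3 : k * N ≤ (n - q) * (n - b) * N := by gcongr
        have i4 : (n - b) * (N * (n - q)) < (n - b) * c := by
          apply mul_lt_mul_of_pos_left h; linarith
        constructor <;> linarith
    have hu0 : 0 < u := pos_of_mul_pos_right bounds.1 hnc.le
    have hu1 : u < 1 := lt_of_mul_lt_mul_left bounds.2 hnc.le
    rw [e, sin_add_nat_mul_pi]
    have h3 : ((-1 : ℝ) ^ a) * (-1) ^ a = 1 := by rw [← mul_pow]; simp
    rw [← mul_assoc, h3, one_mul]
    exact sin_pos_of_pos_of_lt_pi (by positivity) (by nlinarith [pi_pos])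

/-! ### Products along arithmetic progressions modulo `n` -/

lemma exists_add_natCast_mul_eq {n p : ℕ} [NeZero n] (hcop : Nat.Coprime p n) (z w : ZMod n) :
    ∃ i < n, z + (i : ZMod n) * p = w := by
  refine ⟨((w - z) * (p : ZMod n)⁻¹).val, ZMod.val_lt _, ?_⟩
  simp only [ZMod.natCast_val, ZMod.cast_id', id_eq]
  rw [mul_assoc, mul_comm _ (p : ZMod n), ZMod.coe_mul_inv_eq_one p hcop]
  ring

@[to_additive]
lemma prod_range_progression_eq_prod_univ {M : Type*} [CommMonoid M] {n : ℕ} [NeZero n] {p : ℕ}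
    (hcop : Nat.Coprime p n) (f : ZMod n → M) (z : ZMod n) :
    ∏ i ∈ range n, f (z + (i : ZMod n) * p) = ∏ w, f w := by
  have hp : IsUnit (p : ZMod n) := ⟨ZMod.unitOfCoprime p hcop, rfl⟩
  refine Finset.prod_nbij (fun i => z + (i : ZMod n) * p) (by simp) ?_ ?_ (fun _ _ => rfl)
  · intro i hi j hj hij
    have h := hp.mul_right_cancel (add_left_cancel hij)
    rw [ZMod.natCast_eq_natCast_iff', Nat.mod_eq_of_lt (by simpa using hi),
      Nat.mod_eq_of_lt (by simpa using hj)] at h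
    exact h
  · intro w _
    obtain ⟨i, hi, hw⟩ := exists_add_natCast_mul_eq hcop z w
    exact ⟨i, by simpa using hi, hw⟩

@[to_additive]
lemma prod_Icc_natCast_eq_prod_univ {M : Type*} [CommMonoid M] {n : ℕ} [NeZero n]
    (f : ZMod n → M) : ∏ j ∈ Icc 1 n, f j = ∏ w, f w := by
  rw [← prod_range_progression_eq_prod_univ (Nat.coprime_one_left n) f 1, Finset.range_eq_Ico,
    show Icc 1 n = Ico (0 + 1) (n + 1) by ext; simp,
    ← Finset.prod_Ico_add' (fun j : ℕ => f j) 0 n 1]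
  simp [add_comm]

/-- The number of `z ∈ J` with `z + k * p ∉ J` is invariant under `k ↦ n - k`, so a product of
signs over such pairs is trivial if the signs share this invariance. -/
lemma prod_boundary_eq_one {n : ℕ} [NeZero n] (p : ZMod n) (J : Finset (ZMod n)) (τ : ℕ → ℝ)
    (hτ : ∀ k, τ k * τ k = 1) (hrefl : ∀ k, 0 < k → k < n → τ (n - k) = τ k)
    (hmid : ∀ k, 0 < k → 2 * k = n → τ k = 1) :
    ∏ z : ZMod n, ∏ k ∈ range n,
      (if z ∈ J ∧ z + (k : ZMod n) * p ∉ J then τ k else 1) = 1 := by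
  rw [Finset.prod_comm, Finset.prod_range_eq_mul_Ico _ (NeZero.pos n)]
  have h0 : ∏ z : ZMod n, (if z ∈ J ∧ z + ((0 : ℕ) : ZMod n) * p ∉ J then τ 0 else 1) = 1 :=
    Finset.prod_eq_one fun z _ => by simp
  rw [h0, one_mul]
  have hpow : ∀ k : ℕ, ∏ z : ZMod n, (if z ∈ J ∧ z + (k : ZMod n) * p ∉ J then τ k else 1) =
      τ k ^ (#{z | z ∈ J ∧ z + (k : ZMod n) * p ∉ J}) := fun k => by
    rw [Finset.prod_ite, Finset.prod_const, Finset.prod_const_one, mul_one]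
  simp only [hpow]
  have hcard : ∀ k, 0 < k → k < n →
      #{z | z ∈ J ∧ z + ((n - k : ℕ) : ZMod n) * p ∉ J} =
        #{z | z ∈ J ∧ z + (k : ZMod n) * p ∉ J} := by
    intro k _ hk
    set w : ZMod n := (k : ZMod n) * p
    have hw : ((n - k : ℕ) : ZMod n) * p = -w := by
      rw [Nat.cast_sub hk.le]
      simp [w]
    rw [hw]
    have e1 : #{z | z ∈ J ∧ z + -w ∉ J} = #{z | z + w ∈ J ∧ z ∉ J} := by
      refine Finset.card_nbij' (fun z => z - w) (fun z => z + w) ?_ ?_ ?_ ?_ <;>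
        simp [Set.MapsTo, Set.LeftInvOn, sub_eq_add_neg]
    have e2 : #{z | z + w ∈ J} = #J := by
      refine Finset.card_nbij' (fun z => z + w) (fun z => z - w) ?_ ?_ ?_ ?_ <;>
        simp [Set.MapsTo, Set.LeftInvOn]
    rw [e1]
    have e3 := Finset.card_sdiff_comm e2
    convert e3 using 2 <;> ext z <;> simp
  refine Finset.prod_involution (fun k _ => n - k) ?_ ?_ ?_ ?_
  · intro k hk
    simp only [Finset.mem_Ico] at hk
    rw [hrefl k (by omega) hk.2, hcard k (by omega) hk.2, ← mul_pow, hτ, one_pow]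
  · intro k hk hne h
    simp only [Finset.mem_Ico] at hk
    exact hne (by rw [hmid k (by omega) (by omega), one_pow])
  · intro k hk
    simp only [Finset.mem_Ico] at hk ⊢
    omega
  · intro k hk
    simp only [Finset.mem_Ico] at hk
    omega

/-! ### Differences of coordinates along the progression of step `p` -/

lemma exists_sub_eq_of_step {n : ℕ} {p : ZMod n} {g s c : ℝ} {F : ZMod n → ℝ} {m : ZMod n → ℕ}
    (hF : ∀ z, ∃ t : ℤ, F z - F (z + p) = g + s * m z + c * t) (z : ZMod n) (k : ℕ) :
    ∃ t : ℤ, F z - F (z + (k : ZMod n) * p) =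
      k * g + s * (∑ i ∈ range k, m (z + (i : ZMod n) * p) : ℕ) + c * t := by
  induction k with
  | zero => exact ⟨0, by simp⟩
  | succ k ih =>
    obtain ⟨t, ht⟩ := ih
    obtain ⟨t', ht'⟩ := hF (z + (k : ZMod n) * p)
    refine ⟨t + t', ?_⟩
    rw [show z + ((k + 1 : ℕ) : ZMod n) * p = z + (k : ZMod n) * p + p by push_cast; ring,
      Finset.sum_range_succ]
    push_cast at ht ⊢
    linear_combination ht + ht'

/-- Each pair of factors of the two products `V_ν`, belonging to a root of height `k`, has the sign
`σ (k + 1) * σ (k - 1)`. -/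
lemma sin_ratio_pair_pos {n p : ℕ} [NeZero n] {α g s : ℝ} {N : ℕ} {σ : ℕ → ℝ}
    (hα : 0 < α) (hcop : Nat.Coprime p n) (hσ : ∀ k, σ k * σ k = 1)
    (hsin : ∀ k ≤ n, ∀ S : ℕ, S ≤ N → (k = 0 → 0 < S) → (k = n → S < N) →
      0 < σ k * sin (α * (k * g + s * S) / 2))
    {F F' : ZMod n → ℝ} {m m' : ZMod n → ℕ}
    (hF : ∀ z, ∃ t : ℤ, F z - F (z + p) = g + s * m z + 2 * π / α * t)
    (hF' : ∀ z, ∃ t : ℤ, F' z - F' (z + p) = g + s * m' z + 2 * π / α * t)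
    (hm : ∑ z, m z = N) (hm' : ∑ z, m' z = N)
    {z w : ZMod n} {k : ℕ} (hk0 : 0 < k) (hkn : k < n) (hw : z + (k : ZMod n) * p = w)
    (h0 : z + p = w → 0 < m' z) (h1 : w + p = z → 0 < m w) :
    sin (α * (F z - F w) / 2) ≠ 0 ∧ sin (α * (-(F' z - F' w)) / 2) ≠ 0 ∧
    0 < σ (k + 1) * σ (k - 1) *
      (sin (α * (F z - F w + g) / 2) / sin (α * (F z - F w) / 2) *
        (sin (α * (-(F' z - F' w) + g) / 2) / sin (α * (-(F' z - F' w)) / 2))) := by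
  subst hw
  obtain ⟨t, ht⟩ := exists_sub_eq_of_step hF z k
  obtain ⟨t', ht'⟩ := exists_sub_eq_of_step hF' z k
  have hSn : ∀ f : ZMod n → ℕ, ∑ i ∈ range k, f (z + (i : ZMod n) * p) ≤ ∑ w, f w := fun f => by
    rw [← sum_range_progression_eq_sum_univ hcop f z]
    exact Finset.sum_le_sum_of_subset (by simpa using hkn.le)
  have hS : ∑ i ∈ range k, m (z + (i : ZMod n) * p) ≤ N := hm ▸ hSn m
  have hS' : ∑ i ∈ range k, m' (z + (i : ZMod n) * p) ≤ N := hm' ▸ hSn m'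
  have hS0 : k - 1 = 0 → 0 < ∑ i ∈ range k, m' (z + (i : ZMod n) * p) := fun h => by
    obtain rfl : k = 1 := by omega
    simpa using h0
  have hS1 : k + 1 = n → ∑ i ∈ range k, m (z + (i : ZMod n) * p) < N := fun h => by
    have e := sum_range_progression_eq_sum_univ hcop m z
    have hpos := h1 (by
      have : ((k + 1 : ℕ) : ZMod n) = 0 := by rw [h]; simp
      push_cast at this
      linear_combination (p : ZMod n) * this)
    rw [hm] at e
    nth_rewrite 1 [← h] at e
    rw [Finset.sum_range_succ] at e
    omega
  set S := ∑ i ∈ range k, m (z + (i : ZMod n) * p)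
  set S' := ∑ i ∈ range k, m' (z + (i : ZMod n) * p)
  have p1 := hsin k hkn.le S hS (by omega) (by omega)
  have p2 := hsin k hkn.le S' hS' (by omega) (by omega)
  have p3 := hsin (k + 1) hkn S hS (by omega) hS1
  have p4 := hsin (k - 1) (by omega) S' hS' hS0 (by omega)
  rw [Nat.cast_sub (by omega)] at p4
  push_cast at p3 p4
  have hαc : α * (2 * π / α) = 2 * π := by field_simp
  have s1 : sin (α * (F z - F (z + k * p)) / 2) = (-1) ^ t * sin (α * (k * g + s * S) / 2) := by
    rw [← sin_add_int_mul_pi]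
    congr 1
    linear_combination α / 2 * ht + t / 2 * hαc
  have s3 : sin (α * (F z - F (z + k * p) + g) / 2) =
      (-1) ^ t * sin (α * ((k + 1) * g + s * S) / 2) := by
    rw [← sin_add_int_mul_pi]
    congr 1
    linear_combination α / 2 * ht + t / 2 * hαc
  have s2 : sin (α * (-(F' z - F' (z + k * p))) / 2) =
      -((-1) ^ t' * sin (α * (k * g + s * S') / 2)) := by
    rw [← sin_add_int_mul_pi, ← sin_neg]
    congr 1
    linear_combination -α / 2 * ht' - t' / 2 * hαc
  have s4 : sin (α * (-(F' z - F' (z + k * p)) + g) / 2) =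
      -((-1) ^ t' * sin (α * ((k - 1) * g + s * S') / 2)) := by
    rw [← sin_add_int_mul_pi, ← sin_neg]
    congr 1
    linear_combination -α / 2 * ht' - t' / 2 * hαc
  have ht0 : ((-1 : ℝ) ^ t) ≠ 0 := zpow_ne_zero _ (by norm_num)
  have ht0' : ((-1 : ℝ) ^ t') ≠ 0 := zpow_ne_zero _ (by norm_num)
  have n1 := right_ne_zero_of_mul p1.ne'
  have n2 := right_ne_zero_of_mul p2.ne'
  have hσk := left_ne_zero_of_mul p1.ne'
  rw [s1, s2, s3, s4, neg_div_neg_eq, mul_div_mul_left _ _ ht0, mul_div_mul_left _ _ ht0']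
  refine ⟨mul_ne_zero ht0 n1, neg_ne_zero.2 (mul_ne_zero ht0' n2), ?_⟩
  have := div_pos (mul_pos p3 p4) (mul_pos p1 p2)
  refine this.trans_eq ?_
  rw [mul_mul_mul_comm (σ k), hσ]
  field_simp

/-! ### Vectors as functions on `ZMod n` -/

lemma inn_add_right {n : ℕ} (a x y : Fin n → ℝ) : inn a (x + y) = inn a x + inn a y := by
  simp [inn, mul_add, Finset.sum_add_distrib]

lemma inn_smul_right {n : ℕ} (a x : Fin n → ℝ) (t : ℝ) : inn a (t • x) = t * inn a x := by
  simp only [inn, Finset.mul_sum, Pi.smul_apply, smul_eq_mul]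
  exact Finset.sum_congr rfl fun _ _ => by ring

lemma inn_neg_right {n : ℕ} (a x : Fin n → ℝ) : inn a (-x) = -inn a x := by
  simp [inn]

lemma inn_sub_left {n : ℕ} (a b x : Fin n → ℝ) : inn (a - b) x = inn a x - inn b x := by
  simp [inn, sub_mul, Finset.sum_sub_distrib]

lemma inn_sum_right {n : ℕ} {ι : Type*} (a : Fin n → ℝ) (s : Finset ι) (x : ι → Fin n → ℝ) :
    inn a (∑ i ∈ s, x i) = ∑ i ∈ s, inn a (x i) := by
  simp only [inn, Finset.sum_apply, Finset.mul_sum]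
  exact Finset.sum_comm

/-- The coordinate of `x` at the (1-based, `n`-periodic) index `z`. -/
def zcoord {n : ℕ} (x : Fin n → ℝ) (z : ZMod n) : ℝ := inn (ee n z.val) x

lemma inn_ee {n : ℕ} (x : Fin n → ℝ) (j : ℕ) : inn (ee n j) x = zcoord x (j : ZMod n) := by
  simp [zcoord, inn, ee, ZMod.val_natCast]

lemma zcoord_add {n : ℕ} (x y : Fin n → ℝ) (z : ZMod n) :
    zcoord (x + y) z = zcoord x z + zcoord y z := inn_add_right _ _ _

lemma zcoord_smul {n : ℕ} (t : ℝ) (x : Fin n → ℝ) (z : ZMod n) :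
    zcoord (t • x) z = t * zcoord x z := inn_smul_right _ _ _

lemma zcoord_neg {n : ℕ} (x : Fin n → ℝ) (z : ZMod n) : zcoord (-x) z = -zcoord x z :=
  inn_neg_right _ _

lemma exists_zcoord_eq_apply {n : ℕ} [NeZero n] (x : Fin n → ℝ) (z : ZMod n) :
    ∃ i, zcoord x z = x i := by
  have hn := NeZero.pos n
  refine ⟨⟨(z.val + (n - 1)) % n, Nat.mod_lt _ hn⟩, ?_⟩
  unfold zcoord inn
  rw [Finset.sum_eq_single ⟨(z.val + (n - 1)) % n, Nat.mod_lt _ hn⟩]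
  · have : z.val + (n - 1) + 1 = z.val + n := by omega
    simp [ee, this]
  · intro i _ hi
    have : ¬ ((i : ℕ) + 1) % n = z.val % n := by
      intro h
      apply hi
      ext
      have h' : ((i : ℕ) + 1 + (n - 1)) ≡ z.val + (n - 1) [MOD n] := Nat.ModEq.add_right _ h
      rw [show (i : ℕ) + 1 + (n - 1) = i + n by omega] at h'
      have : (i + n) % n = (z.val + (n - 1)) % n := h'
      rw [Nat.add_mod_right, Nat.mod_eq_of_lt i.2] at this
      exact this
    simp [ee, this]
  · simp

lemma exists_zcoord_orbit {n r : ℕ} [NeZero n] {ν : Fin n → ℝ} (hν : inOrbit n r ν) :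
    ∃ J : Finset (ZMod n), ∀ z, zcoord ν z = (if z ∈ J then 1 else 0) - (r : ℝ) / n := by
  obtain ⟨σ, rfl⟩ := hν
  refine ⟨Finset.univ.filter fun z => zcoord (fun i => omegaStd n r (σ i)) z = 1 - (r : ℝ) / n,
    fun z => ?_⟩
  obtain ⟨i, hi⟩ := exists_zcoord_eq_apply (fun i => omegaStd n r (σ i)) z
  simp only [Finset.mem_filter, Finset.mem_univ, true_and, hi]
  unfold omegaStd
  by_cases h : (σ i : ℕ) + 1 ≤ r
  · simp [h]
  · have h1 : -((r : ℝ) / n) ≠ 1 - (r : ℝ) / n := fun h => by linarith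
    simp [h, h1]

lemma Vnu_eq_prod_zcoord {n : ℕ} [NeZero n] (α g : ℝ) (ν x : Fin n → ℝ) :
    Vnu n α g ν x = ∏ z : ZMod n, ∏ w : ZMod n,
      if zcoord ν z - zcoord ν w = 1 then
        sin (α * (zcoord x z - zcoord x w + g) / 2) / sin (α * (zcoord x z - zcoord x w) / 2)
      else 1 := by
  rw [← prod_Icc_natCast_eq_prod_univ]
  refine Finset.prod_congr rfl fun j _ => ?_
  rw [← prod_Icc_natCast_eq_prod_univ]
  refine Finset.prod_congr rfl fun k _ => ?_
  simp only [inn_sub_left, inn_ee]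
  refine if_congr ⟨fun h => h.2, fun h => ⟨?_, h⟩⟩ rfl rfl
  rintro rfl
  simp at h

lemma sum_zcoord_sub_eq_zero {n : ℕ} [NeZero n] (x : Fin n → ℝ) (p : ZMod n) :
    ∑ z, (zcoord x z - zcoord x (z + p)) = 0 := by
  rw [Finset.sum_sub_distrib, sub_eq_zero]
  exact (Equiv.sum_comp (Equiv.addRight p) (zcoord x)).symm

lemma sum_val_eq_sum_range {n : ℕ} [NeZero n] (f : ℕ → ℝ) :
    ∑ z : ZMod n, f z.val = ∑ i ∈ range n, f i := by
  rw [← sum_range_progression_eq_sum_univ (Nat.coprime_one_left n) _ 0]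
  refine Finset.sum_congr rfl fun i hi => ?_
  simp [ZMod.val_natCast, Nat.mod_eq_of_lt (Finset.mem_range.1 hi)]

lemma sum_Icc_eq_sum_range_sub {n : ℕ} (hn : 0 < n) (f : ℕ → ℝ) :
    ∑ j ∈ Icc 1 (n - 1), f j = ∑ i ∈ range n, f i - f 0 := by
  rw [Finset.sum_range_eq_add_Ico _ hn, show Icc 1 (n - 1) = Ico 1 n by ext; simp; omega]
  ring

/-- Coordinate differences of a combination of fundamental weights. -/
lemma zcoord_sub_sum_smul {n p : ℕ} [NeZero n] {ω : ℕ → Fin n → ℝ}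
    (hωδ : ∀ j : ℕ, 1 ≤ j → j ≤ n - 1 → ∀ k : ℕ, 1 ≤ k → k ≤ n - 1 →
      inn (aa n p j) (ω k) = if j = k then (1 : ℝ) else 0) (a : ℕ → ℝ) (z : ZMod n) :
    zcoord (∑ j ∈ Icc 1 (n - 1), a j • ω j) z - zcoord (∑ j ∈ Icc 1 (n - 1), a j • ω j) (z + p) =
      if z = 0 then -∑ j ∈ Icc 1 (n - 1), a j else a z.val := by
  set x := ∑ j ∈ Icc 1 (n - 1), a j • ω j with hx
  have hn := NeZero.pos n
  have hne : ∀ w : ZMod n, w ≠ 0 → zcoord x w - zcoord x (w + p) = a w.val := by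
    intro w hw
    have hw1 : 1 ≤ w.val := Nat.one_le_iff_ne_zero.2 (by simpa using hw)
    have hw2 : w.val ≤ n - 1 := by have := w.val_lt; omega
    have e : zcoord x w - zcoord x (w + p) = inn (aa n p w.val) x := by
      rw [aa, inn_sub_left, inn_ee, inn_ee]
      simp
    rw [e, hx, inn_sum_right, Finset.sum_eq_single w.val]
    · rw [inn_smul_right, hωδ _ hw1 hw2 _ hw1 hw2]
      simp
    · intro j hj hjw
      rw [Finset.mem_Icc] at hj
      rw [inn_smul_right, hωδ _ hw1 hw2 _ hj.1 hj.2, if_neg hjw.symm, mul_zero]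
    · intro h
      exact absurd (Finset.mem_Icc.2 ⟨hw1, hw2⟩) h
  split_ifs with hz
  · subst hz
    have h0 := sum_zcoord_sub_eq_zero x (p : ZMod n)
    have h1 := sum_val_eq_sum_range (n := n) a
    rw [← Finset.add_sum_erase _ _ (Finset.mem_univ (0 : ZMod n))] at h0 h1
    rw [Finset.sum_congr rfl fun w hw => hne w (Finset.ne_of_mem_erase hw)] at h0
    rw [sum_Icc_eq_sum_range_sub hn, ← h1, ZMod.val_zero]
    linarith
  · exact hne z hz

lemma exists_zcoord_Lam {n p N : ℕ} [NeZero n] {ω : ℕ → Fin n → ℝ}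
    (hωδ : ∀ j : ℕ, 1 ≤ j → j ≤ n - 1 → ∀ k : ℕ, 1 ≤ k → k ≤ n - 1 →
      inn (aa n p j) (ω k) = if j = k then (1 : ℝ) else 0)
    {μ : Fin n → ℝ} (hμ : μ ∈ Lam n N ω) :
    ∃ m : ZMod n → ℕ, ∑ z, m z = N ∧
      ∀ z, zcoord μ z - zcoord μ (z + p) = m z - if z = 0 then (N : ℝ) else 0 := by
  obtain ⟨a, ha, rfl⟩ := hμ
  have hsum : ∑ j ∈ Icc 1 (n - 1), a j ≤ N := by exact_mod_cast ha
  have key := zcoord_sub_sum_smul hωδ (fun j => (a j : ℝ))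
  have hm : ∀ z : ZMod n,
      zcoord (∑ j ∈ Icc 1 (n - 1), (a j : ℝ) • ω j) z -
        zcoord (∑ j ∈ Icc 1 (n - 1), (a j : ℝ) • ω j) (z + p) =
      ((if z = 0 then N - ∑ j ∈ Icc 1 (n - 1), a j else a z.val : ℕ) : ℝ) -
        if z = 0 then (N : ℝ) else 0 := by
    intro z
    rw [key z]
    split_ifs
    · push_cast [hsum]
      ring
    · simp
  refine ⟨_, ?_, hm⟩
  have h0 := sum_zcoord_sub_eq_zero (∑ j ∈ Icc 1 (n - 1), (a j : ℝ) • ω j) (p : ZMod n)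
  rw [Finset.sum_congr rfl fun z _ => hm z, Finset.sum_sub_distrib] at h0
  rw [Finset.sum_ite_eq' Finset.univ (0 : ZMod n), if_pos (Finset.mem_univ _), sub_eq_zero] at h0
  exact_mod_cast h0

/-- The coordinate differences of `ρ_p` all equal `g` modulo `2π/α`, up to a correction `M` at the
affine root. -/
lemma exists_zcoord_rhoP {n p : ℕ} [NeZero n] {α g : ℝ} (hp1 : 1 ≤ p) (hpn : p ≤ n - 1)
    {ω : ℕ → Fin n → ℝ}
    (hωδ : ∀ j : ℕ, 1 ≤ j → j ≤ n - 1 → ∀ k : ℕ, 1 ≤ k → k ≤ n - 1 →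
      inn (aa n p j) (ω k) = if j = k then (1 : ℝ) else 0) (z : ZMod n) :
    ∃ t : ℤ, zcoord (rhoP n p α g ω) z - zcoord (rhoP n p α g ω) (z + p) =
      g + (if z = 0 then 2 * π * p / α - n * g else 0) + 2 * π / α * t := by
  have hsplit : ∀ {A : Type} [AddCommMonoid A] (f : ℕ → A),
      ∑ j ∈ Icc 1 (n - 1), f j =
        ∑ j ∈ Icc 1 (n - p), f j + ∑ j ∈ Icc (n - p + 1) (n - 1), f j := by
    intro A _ f
    rw [← Finset.sum_union]
    · congr 1
      ext
      simp
      omega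
    · rw [Finset.disjoint_left]
      intro j
      simp
      omega
  set a : ℕ → ℝ := fun j => if j ≤ n - p then g else g - 2 * π / α with ha
  have e1 : ∀ j ∈ Icc 1 (n - p), a j = g := fun j hj => if_pos (Finset.mem_Icc.1 hj).2
  have e2 : ∀ j ∈ Icc (n - p + 1) (n - 1), a j = g - 2 * π / α := fun j hj =>
    if_neg (by have := (Finset.mem_Icc.1 hj).1; omega)
  have hrho : rhoP n p α g ω = ∑ j ∈ Icc 1 (n - 1), a j • ω j := by
    rw [hsplit, rhoP, Finset.smul_sum, Finset.smul_sum]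
    congr 1
    · exact Finset.sum_congr rfl fun j hj => by rw [e1 j hj]
    · exact Finset.sum_congr rfl fun j hj => by rw [e2 j hj]
  rw [hrho, zcoord_sub_sum_smul hωδ]
  split_ifs with hz
  · refine ⟨-1, ?_⟩
    rw [hsplit, Finset.sum_congr rfl e1, Finset.sum_congr rfl e2]
    simp only [Finset.sum_const, Nat.card_Icc, nsmul_eq_mul]
    rw [show n - p + 1 - 1 = n - p by omega, show n - 1 + 1 - (n - p + 1) = p - 1 by omega,
      Nat.cast_sub hp1, Nat.cast_sub (by omega : p ≤ n)]
    push_cast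
    ring
  · by_cases h : z.val ≤ n - p
    · exact ⟨0, by simp [ha, h]⟩
    · exact ⟨-1, by simp [ha, h]; ring⟩

/-- For a type (i) coupling, `|M|` is bounded by `2π/(αq)` or `2π/(α(n-q))` according to the sign
of `M`. -/
lemma sign_and_bound_of_typeI {n p q : ℕ} {α g : ℝ} (hn : 0 < n) (hα : 0 < α)
    (htype : TypeI n p q α g) (hM0 : 2 * π * p / α - n * g ≠ 0) :
    (Real.sign (2 * π * p / α - n * g) = 1 ∨ Real.sign (2 * π * p / α - n * g) = -1) ∧
    2 * π * p / α - n * g =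
      Real.sign (2 * π * p / α - n * g) * |2 * π * p / α - n * g| ∧
    ((Real.sign (2 * π * p / α - n * g) = 1 ∧ |2 * π * p / α - n * g| * q < 2 * π / α) ∨
      (Real.sign (2 * π * p / α - n * g) = -1 ∧
        |2 * π * p / α - n * g| * (n - q) < 2 * π / α)) := by
  obtain ⟨hq1, hqn, -, h⟩ := htype
  have hnR : (0 : ℝ) < n := by exact_mod_cast hn
  have hqR : (0 : ℝ) < q := by exact_mod_cast hq1
  have hqnR : (0 : ℝ) < n - q := by
    have : (q : ℝ) < n := by exact_mod_cast (by omega : q < n)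
    linarith
  have e : 2 * π * p / α - n * g = n * (2 * π / α * (p / n) - g) := by field_simp
  rcases hM0.lt_or_gt with hneg | hpos
  · rw [Real.sign_of_neg hneg, abs_of_neg hneg]
    refine ⟨Or.inr rfl, by ring, Or.inr ⟨rfl, ?_⟩⟩
    rcases h with ⟨-, h⟩ | ⟨-, h⟩
    · rw [e] at hneg
      nlinarith
    · have h' : (g - 2 * π / α * (p / n)) * (n * (n - q)) <
          2 * π / α * (1 / (n * (n - q))) * (n * (n - q)) := by
        gcongr
        linarith
      have e' : 2 * π / α * (1 / (n * (n - q))) * (n * (n - q)) = 2 * π / α := by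
        field_simp
      rw [e'] at h'
      rw [e]
      linarith
  · rw [Real.sign_of_pos hpos, abs_of_pos hpos]
    refine ⟨Or.inl rfl, by ring, Or.inl ⟨rfl, ?_⟩⟩
    rcases h with ⟨h, -⟩ | ⟨h, -⟩
    · have h' : (2 * π / α * (p / n) - g) * (n * q) <
          2 * π / α * (1 / (n * q)) * (n * q) := by
        gcongr
        linarith
      have e' : 2 * π / α * (1 / (n * q)) * (n * q) = 2 * π / α := by
        field_simp
      rw [e'] at h'
      rw [e]
      linarith
    · rw [e] at hpos
      nlinarith

/-- Lemma 2.2, first part: for `μ, μ+ν ∈ Λ⁺_{p,|M|}`, all sine denominators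
in `V_ν(g;ρ_p+sgn(M)μ)` and `V_ν(g;-ρ_p-sgn(M)(μ+ν))` are nonzero and the product of the
two values is strictly positive. -/
theorem statement7 (n p q : ℕ) (α g : ℝ)
    (hn : 2 ≤ n) (hα : 0 < α) (hp1 : 1 ≤ p) (hpn : p ≤ n - 1) (hcop : Nat.Coprime p n)
    (htype : TypeI n p q α g)
    (Mz : ℤ) (hMz : 2 * π * p / α - n * g = (Mz : ℝ)) (hMz0 : Mz ≠ 0)
    (ω : ℕ → Fin n → ℝ)
    (hωE : ∀ k : ℕ, 1 ≤ k → k ≤ n - 1 → ∑ i, ω k i = 0)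
    (hωδ : ∀ j : ℕ, 1 ≤ j → j ≤ n - 1 → ∀ k : ℕ, 1 ≤ k → k ≤ n - 1 →
      inn (aa n p j) (ω k) = if j = k then (1 : ℝ) else 0)
    (r : ℕ) (hr1 : 1 ≤ r) (hrn : r ≤ n - 1)
    (ν : Fin n → ℝ) (hν : inOrbit n r ν)
    (μ : Fin n → ℝ) (hμ : μ ∈ Lam n |2 * π * p / α - n * g| ω)
    (hμν : μ + ν ∈ Lam n |2 * π * p / α - n * g| ω) :
    (∀ j ∈ Icc 1 n, ∀ k ∈ Icc 1 n, j ≠ k → inn (ee n j - ee n k) ν = 1 →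
      Real.sin (α * inn (ee n j - ee n k)
        (rhoP n p α g ω + Real.sign (2 * π * p / α - n * g) • μ) / 2) ≠ 0 ∧
      Real.sin (α * inn (ee n j - ee n k)
        (-(rhoP n p α g ω) - Real.sign (2 * π * p / α - n * g) • (μ + ν)) / 2) ≠ 0) ∧
    0 < Vnu n α g ν (rhoP n p α g ω + Real.sign (2 * π * p / α - n * g) • μ) *
        Vnu n α g ν
          (-(rhoP n p α g ω) - Real.sign (2 * π * p / α - n * g) • (μ + ν)) := by
  have : NeZero n := ⟨by omega⟩
  have hqn : q < n := by have := htype.2.1; omega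
  obtain ⟨hs1, hMs, hbound⟩ := sign_and_bound_of_typeI (by omega) hα htype
    (hMz ▸ Int.cast_ne_zero.2 hMz0)
  obtain ⟨N, hN⟩ : ∃ N : ℕ, |2 * π * p / α - n * g| = N := by
    refine ⟨Mz.natAbs, ?_⟩
    rw [hMz, Nat.cast_natAbs, Int.cast_abs]
  rw [hN] at hμ hμν hMs hbound
  have hN0 : (0 : ℝ) < N := by
    rw [← hN, hMz]
    exact abs_pos.2 (by exact_mod_cast hMz0)
  set s := Real.sign (2 * π * p / α - n * g)
  obtain ⟨J, hJ⟩ := exists_zcoord_orbit hν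
  obtain ⟨m, hm, hmz⟩ := exists_zcoord_Lam hωδ hμ
  obtain ⟨m', hm', hmz'⟩ := exists_zcoord_Lam hωδ hμν
  have step : ∀ {x : Fin n → ℝ} {l : ZMod n → ℕ},
      (∀ z, zcoord x z - zcoord x (z + p) = l z - if z = 0 then (N : ℝ) else 0) →
      ∀ z, ∃ t : ℤ, zcoord (rhoP n p α g ω + s • x) z - zcoord (rhoP n p α g ω + s • x) (z + p) =
        g + s * l z + 2 * π / α * t := by
    intro x l hx z
    obtain ⟨t, ht⟩ := exists_zcoord_rhoP (g := g) (α := α) hp1 hpn hωδ z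
    refine ⟨t, ?_⟩
    have h := hx z
    simp only [zcoord_add, zcoord_smul]
    split_ifs at h ht
    · linear_combination ht + s * h + hMs
    · linear_combination ht + s * h
  have hcond : ∀ z w, zcoord ν z - zcoord ν w = 1 ↔ z ∈ J ∧ w ∉ J := by
    intro z w
    rw [hJ, hJ]
    by_cases hz : z ∈ J <;> by_cases hw : w ∈ J <;>
      simp only [hz, hw, if_true, if_false, not_true, not_false_iff, and_true, and_false,
        iff_true, iff_false] <;> linarith
  have hmm : ∀ z, (m' z : ℝ) - m z = zcoord ν z - zcoord ν (z + p) := by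
    intro z
    have h1 := hmz z
    have h2 := hmz' z
    simp only [zcoord_add] at h2
    linear_combination h1 - h2
  have hσ := sineSign_mul_self (n := n) (p := p) hs1
  have pair : ∀ z w (k : ℕ), k < n → z + (k : ZMod n) * p = w → zcoord ν z - zcoord ν w = 1 → _ :=
    fun z w k hkn hw hzw => sin_ratio_pair_pos (k := k) (z := z) (w := w) hα hcop hσ
      (fun k hk S hS h0 h1 => sineSign_mul_sin_pos hn hα htype.1 hqn htype.2.2.1
        (by rw [← hMs]; ring) hN0 hbound hk S.cast_nonneg (by exact_mod_cast hS)
        (fun h => by exact_mod_cast h0 h) (fun h => by exact_mod_cast h1 h))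
      (step hmz) (step hmz') hm hm' (by
        rcases Nat.eq_zero_or_pos k with rfl | h
        · simp at hw
          simp [hw] at hzw
        · exact h) hkn hw
      (fun h => by
        have := hmm z
        rw [h, hzw] at this
        have : (m' z : ℝ) = m z + 1 := by linarith
        have : m' z = m z + 1 := by exact_mod_cast this
        omega)
      (fun h => by
        have := hmm w
        rw [h] at this
        have : (m w : ℝ) = m' w + 1 := by linarith
        have : m w = m' w + 1 := by exact_mod_cast this
        omega)
  have hneg : -(rhoP n p α g ω) - s • (μ + ν) = -(rhoP n p α g ω + s • (μ + ν)) := by abel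
  rw [hneg]
  constructor
  · intro j _ k _ _ hjk
    simp only [inn_sub_left, inn_ee] at hjk ⊢
    obtain ⟨i, hi, hik⟩ := exists_add_natCast_mul_eq hcop (j : ZMod n) k
    have h := pair _ _ i hi hik hjk
    refine ⟨h.1, ?_⟩
    simp only [zcoord_neg, neg_sub_neg] at h ⊢
    rw [← neg_sub]
    exact h.2.1
  · set τ : ℕ → ℝ := fun k => sineSign n p s (k + 1) * sineSign n p s (k - 1)
    have hτ : ∏ z : ZMod n, ∏ k ∈ range n,
        (if z ∈ J ∧ z + (k : ZMod n) * p ∉ J then τ k else 1) = 1 := by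
      refine prod_boundary_eq_one (p : ZMod n) J τ (fun k => ?_)
        (fun k hk0 hkn => sineSign_neighbours_reflect hs1 hn hcop hk0 hkn) (fun k hk0 hkn => ?_)
      · simp only [τ]
        rw [mul_mul_mul_comm, hσ, hσ, one_mul]
      · have h := sineSign_reflect hs1 hn hcop (show k + 1 ≤ n by omega)
        rw [show n - (k + 1) = k - 1 by omega] at h
        have hodd : ¬ 2 ∣ p := fun h2 => by
          have := Nat.dvd_gcd h2 (Dvd.intro k hkn)
          rw [hcop] at this
          omega
        simp only [τ]
        rw [h, Even.neg_one_pow (by grind)]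
    rw [← one_mul (Vnu _ _ _ _ _ * _), ← hτ, Vnu_eq_prod_zcoord, Vnu_eq_prod_zcoord]
    simp only [← Finset.prod_mul_distrib]
    refine Finset.prod_pos fun z _ => ?_
    rw [← prod_range_progression_eq_prod_univ hcop _ z,
      ← Finset.prod_mul_distrib]
    refine Finset.prod_pos fun k hk => ?_
    by_cases h : zcoord ν z - zcoord ν (z + (k : ZMod n) * p) = 1
    · have hpos := (pair _ _ k (Finset.mem_range.1 hk) rfl h).2.2
      rw [if_pos ((hcond _ _).1 h), if_pos h, if_pos h]
      simp only [zcoord_neg, neg_sub_neg]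
      simpa only [neg_sub] using hpos
    · rw [if_neg (fun h' => h ((hcond _ _).2 h')), if_neg h, if_neg h]
      norm_num
end
end
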